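/- For every δ ∈ (0,1/2) there is a constant c₆(δ) depending only on d ≥ 3 and δ such that the following holds. Let L ≥ 1 and K ≥ max(c₆(δ),100) be integers, let 𝒞 be a nonempty finite subset of 𝕃 = Lℤ^d whose points are at mutual ℓ∞-distance at least (2K+3)L, and set Č = ∪_{z∈𝒞} Ď_z and V̌ = ∪_{z∈𝒞} Ǔ_z. For x ∈ ℤ^d, let Q_x govern two independent continuous-time simple random walks X¹ (started at x) and X² (started with initial distribution ē_Č), and define Y = X¹_{H_Č(X¹)} on the event {H_Č(X¹) < ∞} and Y = X²_0 otherwise. Then for every z ∈ 𝒞, every y ∈ Ď_z and every x ∈ ∂V̌, one has (1 − δ/3)·ē_{Ď_z}(y) ≤ Q_x[Y = y | Y ∈ Ď_z] ≤ (1 + δ/3)·ē_{Ď_z}(y). -/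

import Mathlib

open MeasureTheory ENNReal Set
open scoped Classical NNReal

namespace Disconnection

/-- Points of `ℤ^d`. -/
abbrev Zd (d : ℕ) := Fin d → ℤ

/-- Step distribution of the simple random walk: uniform weight `1/(2d)` on each of the
`2d` unit vectors of `ℤ^d`. -/
noncomputable def stepP (d : ℕ) (v : Zd d) : ℝ≥0∞ :=
  if (∑ i, (v i).natAbs) = 1 then ((2 * d : ℕ) : ℝ≥0∞)⁻¹ else 0

/-- The exponential distribution of rate `1` on `[0,∞)` (as a measure on `ℝ`). -/
noncomputable def expMeasure : Measure ℝ :=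
  MeasureTheory.volume.withDensity fun t => ENNReal.ofReal (if 0 < t then Real.exp (-t) else 0)

/-- Nearest neighbours in `ℤ^d` (Euclidean distance one). -/
def adjacent {d : ℕ} (x y : Zd d) : Prop := (∑ i, (x i - y i).natAbs) = 1

/-- (Outer) boundary `∂A` of a set `A ⊆ ℤ^d`. -/
def bdry {d : ℕ} (A : Set (Zd d)) : Set (Zd d) := {y | y ∉ A ∧ ∃ x ∈ A, adjacent x y}

/-- sup-norm distance between two points of `ℤ^d`. -/
def supDist {d : ℕ} (x y : Zd d) : ℕ := Finset.univ.sup fun i => (x i - y i).natAbs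

/-- closed sup-norm ball `B(x,r)` in `ℤ^d`. -/
def ball {d : ℕ} (x : Zd d) (r : ℕ) : Set (Zd d) := {y | supDist x y ≤ r}

/-- mutual sup-norm distance between two sets. -/
noncomputable def setDist {d : ℕ} (A B : Set (Zd d)) : ℕ := sInf {n | ∃ x ∈ A, ∃ y ∈ B, supDist x y = n}

/-- the box `ℤ^d ∩ [a,b)^d`. -/
def intBox {d : ℕ} (a b : ℤ) : Set (Zd d) := {y | ∀ i, a ≤ y i ∧ y i < b}

/-- A box in `ℤ^d`: a translate of `[0,L)^d ∩ ℤ^d` with `L ≥ 1`. -/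
def isBox {d : ℕ} (S : Set (Zd d)) : Prop :=
  ∃ L : ℕ, 1 ≤ L ∧ ∃ a : Zd d, S = {y | ∀ i, a i ≤ y i ∧ y i < a i + L}

/-- connectedness of a subset of `ℤ^d` by nearest-neighbour paths. -/
def connSet {d : ℕ} (S : Set (Zd d)) : Prop :=
  ∀ a ∈ S, ∀ b ∈ S, ∃ (n : ℕ) (f : ℕ → Zd d), f 0 = a ∧ f n = b ∧
    (∀ k ≤ n, f k ∈ S) ∧ ∀ k < n, adjacent (f k) (f (k + 1))

/-- Euclidean norm of a lattice point. -/
noncomputable def eucNorm {d : ℕ} (x : Zd d) : ℝ := Real.sqrt (∑ i, ((x i : ℝ)) ^ 2)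

/-- A model of the continuous-time simple random walk on `ℤ^d` with unit jump rate:
`Y` is the discrete jump chain and `ζ` are the holding times; under `P x` one has
`Y 0 = x` a.s., and the increments of `Y` together with the holding times are mutually
independent, the increments uniform on the `2d` unit vectors and the holding times
exponential of rate `1`.  This is expressed through the finite-dimensional cylinder
probabilities, which determine the joint law. -/
structure SRW (d : ℕ) (Ω : Type*) [MeasurableSpace Ω] where
  P : Zd d → Measure Ω
  isProb : ∀ x, IsProbabilityMeasure (P x)
  Y : ℕ → Ω → Zd d
  ζ : ℕ → Ω → ℝ
  measurable_Y : ∀ n, Measurable (Y n)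
  measurable_ζ : ∀ n, Measurable (ζ n)
  Y_zero : ∀ x : Zd d, P x {ω | Y 0 ω = x} = 1
  law : ∀ (x : Zd d) (n : ℕ) (s : Fin n → Zd d) (I : Fin n → Set ℝ),
    (∀ i, MeasurableSet (I i)) →
    P x {ω | (∀ i : Fin n, Y ((i : ℕ) + 1) ω - Y (i : ℕ) ω = s i) ∧
             (∀ i : Fin n, ζ (i : ℕ) ω ∈ I i)}
      = (∏ i, stepP d (s i)) * ∏ i, expMeasure (I i)

namespace SRW

variable {d : ℕ} {Ω : Type*} [MeasurableSpace Ω]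

/-- time of the `n`-th jump. -/
noncomputable def S (W : SRW d Ω) (n : ℕ) (ω : Ω) : ℝ := ∑ i ∈ Finset.range n, W.ζ i ω

/-- index of the current step of the jump chain at time `t`. -/
noncomputable def jumpIdx (W : SRW d Ω) (t : ℝ) (ω : Ω) : ℕ := sSup {k : ℕ | W.S k ω ≤ t}

/-- the continuous-time walk `X_t`. -/
noncomputable def X (W : SRW d Ω) (t : ℝ) (ω : Ω) : Zd d := W.Y (W.jumpIdx t ω) ω

/-- entrance time of `A` after time `t` (`∞` if there is none). -/
noncomputable def hitFrom (W : SRW d Ω) (A : Set (Zd d)) (t : ℝ≥0∞) (ω : Ω) : ℝ≥0∞ :=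
  sInf {u : ℝ≥0∞ | ∃ s : ℝ≥0, u = (s : ℝ≥0∞) ∧ t ≤ u ∧ W.X (s : ℝ) ω ∈ A}

/-- entrance time `H_A = inf {t ≥ 0 : X_t ∈ A}`. -/
noncomputable def hit (W : SRW d Ω) (A : Set (Zd d)) (ω : Ω) : ℝ≥0∞ := W.hitFrom A 0 ω

/-- exit time `T_U = inf {t ≥ 0 : X_t ∉ U}`. -/
noncomputable def exit (W : SRW d Ω) (U : Set (Zd d)) (ω : Ω) : ℝ≥0∞ := W.hit Uᶜ ω

/-- hitting time `H̃_A = inf {t ≥ ζ₀ : X_t ∈ A}`. -/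
noncomputable def hitTilde (W : SRW d Ω) (A : Set (Zd d)) (ω : Ω) : ℝ≥0∞ :=
  W.hitFrom A (ENNReal.ofReal (W.ζ 0 ω)) ω

/-- the walk evaluated at a random (possibly infinite) time. -/
noncomputable def Xat (W : SRW d Ω) (τ : Ω → ℝ≥0∞) (ω : Ω) : Zd d := W.X (τ ω).toReal ω

/-- equilibrium measure `e_A(x) = P_x[H̃_A = ∞] 1_A(x)`. -/
noncomputable def eqm (W : SRW d Ω) (A : Set (Zd d)) (x : Zd d) : ℝ :=
  if x ∈ A then (W.P x {ω | W.hitTilde A ω = ⊤}).toReal else 0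

/-- capacity `cap(A) = Σ_x e_A(x)`. -/
noncomputable def cap (W : SRW d Ω) (A : Set (Zd d)) : ℝ := ∑ᶠ x, W.eqm A x

/-- normalized equilibrium measure `ē_A = e_A / cap(A)`. -/
noncomputable def ebar (W : SRW d Ω) (A : Set (Zd d)) (x : Zd d) : ℝ := W.eqm A x / W.cap A

/-- equilibrium measure of `A` relative to `U`: `e_{A,U}(x) = P_x[H̃_A > T_U] 1_A(x)`. -/
noncomputable def eqmRel (W : SRW d Ω) (A U : Set (Zd d)) (x : Zd d) : ℝ :=
  if x ∈ A then (W.P x {ω | W.exit U ω < W.hitTilde A ω}).toReal else 0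

/-- `P_ρ = Σ_x ρ(x) P_x`, the walk started from the initial (sub-)measure with density `ρ`. -/
noncomputable def Pinit (W : SRW d Ω) (ρ : Zd d → ℝ) : Measure Ω :=
  Measure.sum fun x : Zd d => ENNReal.ofReal (ρ x) • W.P x

/-- Green function `g(x,y) = E_x[∫₀^∞ 1{X_s = y} ds]`. -/
noncomputable def green (W : SRW d Ω) (x y : Zd d) : ℝ :=
  ∫ ω, (∫ s in Set.Ioi (0 : ℝ), if W.X s ω = y then (1 : ℝ) else 0) ∂ W.P x

/-- killed Green function `g_U(x,y) = E_x[∫₀^{T_U} 1{X_s = y} ds]`. -/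
noncomputable def greenK (W : SRW d Ω) (U : Set (Zd d)) (x y : Zd d) : ℝ :=
  ∫ ω, (∫ s in Set.Ioi (0 : ℝ),
      if ENNReal.ofReal s < W.exit U ω ∧ W.X s ω = y then (1 : ℝ) else 0) ∂ W.P x

/-- the potential operator `Gf(x) = Σ_y g(x,y) f(y)`. -/
noncomputable def Gop (W : SRW d Ω) (f : Zd d → ℝ) (x : Zd d) : ℝ :=
  ∑ᶠ y, W.green x y * f y

/-- successive return times to `A` (between excursions out of `U`): `Rt A U 0 = R₁ = H_A`. -/
noncomputable def Rt (W : SRW d Ω) (A U : Set (Zd d)) : ℕ → Ω → ℝ≥0∞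
  | 0 => W.hit A
  | k + 1 => fun ω => W.hitFrom A (W.hitFrom Uᶜ (W.Rt A U k ω) ω) ω

/-- successive departure times from `U`: `Dt A U k = D_{k+1}`. -/
noncomputable def Dt (W : SRW d Ω) (A U : Set (Zd d)) (k : ℕ) (ω : Ω) : ℝ≥0∞ :=
  W.hitFrom Uᶜ (W.Rt A U k ω) ω

/-- number of excursions from `A` to the complement of `U`:
`N_{A,U} = sup {k ≥ 1 : D_k < ∞}` (with `sup ∅ = 0`). -/
noncomputable def Nexc (W : SRW d Ω) (A U : Set (Zd d)) (ω : Ω) : ℕ :=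
  sSup {n | 0 < n ∧ W.Dt A U (n - 1) ω < ⊤}

end SRW

end Disconnection

open Disconnection

namespace Pf

/-- unit vectors -/
def u {d : ℕ} (j : Fin d × Bool) : Zd d := Pi.single j.1 (if j.2 then 1 else -1)

def opp {d : ℕ} (j : Fin d × Bool) : Fin d × Bool := (j.1, !j.2)

lemma opp_opp {d : ℕ} (j : Fin d × Bool) : opp (opp j) = j := by simp [opp]

lemma u_opp {d : ℕ} (j : Fin d × Bool) : u (opp j) = - u j := by
  rcases j with ⟨i, b⟩
  cases b <;> simp [u, opp, Pi.single_neg]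

def oppE {d : ℕ} : (Fin d × Bool) ≃ (Fin d × Bool) := ⟨opp, opp, opp_opp, opp_opp⟩

lemma sum_opp {d : ℕ} {M : Type*} [AddCommMonoid M] (f : Fin d × Bool → M) :
    ∑ j, f (opp j) = ∑ j, f j := Equiv.sum_comp oppE f

lemma card_dir {d : ℕ} : (Finset.univ : Finset (Fin d × Bool)).card = 2 * d := by
  simp [Finset.card_univ, mul_comm]

/-- averaging operator -/
noncomputable def av {d : ℕ} (f : Zd d → ℝ) (x : Zd d) : ℝ := (2 * (d : ℝ))⁻¹ * ∑ j, f (x + u j)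

lemma av_mono {d : ℕ} {f g : Zd d → ℝ} (x : Zd d) (h : ∀ j, f (x + u j) ≤ g (x + u j)) :
    av f x ≤ av g x := by
  unfold av
  exact mul_le_mul_of_nonneg_left (Finset.sum_le_sum fun j _ => h j) (by positivity)

lemma av_congr {d : ℕ} {f g : Zd d → ℝ} (x : Zd d) (h : ∀ j, f (x + u j) = g (x + u j)) :
    av f x = av g x := by
  unfold av; simp [h]

lemma av_add {d : ℕ} (f g : Zd d → ℝ) (x : Zd d) :
    av (fun v => f v + g v) x = av f x + av g x := by
  simp [av, Finset.sum_add_distrib, mul_add]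

lemma av_sub {d : ℕ} (f g : Zd d → ℝ) (x : Zd d) :
    av (fun v => f v - g v) x = av f x - av g x := by
  simp [av, Finset.sum_sub_distrib, mul_sub]

lemma av_smul {d : ℕ} (c : ℝ) (f : Zd d → ℝ) (x : Zd d) :
    av (fun v => c * f v) x = c * av f x := by
  simp [av, ← Finset.mul_sum]; ring

lemma av_const {d : ℕ} (hd : 0 < d) (c : ℝ) (x : Zd d) :
    av (fun _ => c) x = c := by
  have : (d : ℝ) ≠ 0 := by positivity
  simp only [av, Finset.sum_const, card_dir, nsmul_eq_mul]; push_cast; field_simp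

lemma av_nonneg {d : ℕ} {f : Zd d → ℝ} (h : ∀ x, 0 ≤ f x) (x : Zd d) : 0 ≤ av f x := by
  unfold av
  exact mul_nonneg (by positivity) (Finset.sum_nonneg fun j _ => h _)

/-- a term is at most `2d` times the average -/
lemma le_av {d : ℕ} (hd : 0 < d) {f : Zd d → ℝ} (h : ∀ x, 0 ≤ f x) (x : Zd d) (j) :
    f (x + u j) ≤ 2 * d * av f x := by
  have : (d : ℝ) ≠ 0 := by positivity
  unfold av
  rw [← mul_assoc, mul_inv_cancel₀ (by positivity), one_mul]
  exact Finset.single_le_sum (f := fun j => f (x + u j)) (fun j _ => h _) (Finset.mem_univ j)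

/-- maximum principle -/
lemma max_principle {d : ℕ} (hd : 0 < d) (S : Finset (Zd d)) (f : Zd d → ℝ)
    (hsub : ∀ x ∈ S, f x ≤ av f x)
    (hb : ∀ x ∈ S, ∀ j, x + u j ∉ S → f (x + u j) ≤ 0) : ∀ x ∈ S, f x ≤ 0 := by
  by_contra! hcon
  obtain ⟨x1, hx1, hx1'⟩ := hcon
  obtain ⟨x0, hx0, hmax⟩ := S.exists_max_image f ⟨x1, hx1⟩
  have hM : 0 < f x0 := hx1'.trans_le (hmax x1 hx1)
  have hstep : ∀ x ∈ S, f x = f x0 → ∀ j, x + u j ∈ S ∧ f (x + u j) = f x0 := by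
    intro x hx hfx j
    have hle : ∀ k, f (x + u k) ≤ f x0 := by
      intro k
      by_cases hk : x + u k ∈ S
      · exact hmax _ hk
      · exact (hb x hx k hk).trans hM.le
    have h1 := hsub x hx
    have heq : f (x + u j) = f x0 := by
      by_contra hne
      have hlt : f (x + u j) < f x0 := lt_of_le_of_ne (hle j) hne
      have : ∑ k, f (x + u k) < ∑ k : Fin d × Bool, f x0 :=
        Finset.sum_lt_sum (fun k _ => hle k) ⟨j, Finset.mem_univ _, hlt⟩
      have h2 : av f x < av (fun _ => f x0) x := by
        unfold av; exact mul_lt_mul_of_pos_left this (by positivity)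
      rw [av_const hd] at h2
      linarith
    refine ⟨?_, heq⟩
    by_contra hn
    have := hb x hx j hn
    linarith
  let j0 : Fin d × Bool := (⟨0, hd⟩, true)
  have hall : ∀ n : ℕ, x0 + n • u j0 ∈ S ∧ f (x0 + n • u j0) = f x0 := by
    intro n
    induction n with
    | zero => simpa using hx0
    | succ n ih =>
      have := hstep _ ih.1 ih.2 j0
      rwa [add_assoc, ← succ_nsmul] at this
  have hinj : Function.Injective fun n : ℕ => x0 + n • u j0 := by
    intro a b hab
    have := congrFun (add_left_cancel hab) ⟨0, hd⟩
    simpa [u, j0] using this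
  exact Set.infinite_of_injective_forall_mem hinj (s := (S : Set (Zd d))) (fun n => (hall n).1)
    S.finite_toSet

/-- Dirichlet problem -/
lemma dirichlet {d : ℕ} (hd : 0 < d) (S : Finset (Zd d)) (f : Zd d → ℝ) :
    ∃ h : Zd d → ℝ, (∀ x, x ∉ S → h x = f x) ∧ ∀ x ∈ S, h x = av h x := by
  let ext : (S → ℝ) → Zd d → ℝ := fun g x => if hx : x ∈ S then g ⟨x, hx⟩ else 0
  have ext_add : ∀ a b, ext (a + b) = fun v => ext a v + ext b v := by
    intro a b; funext v; simp only [ext]; split_ifs <;> simp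
  have ext_smul : ∀ (c : ℝ) a, ext (c • a) = fun v => c * ext a v := by
    intro c a; funext v; simp only [ext]; split_ifs <;> simp
  let T : (S → ℝ) →ₗ[ℝ] (S → ℝ) :=
    { toFun := fun g x => g x - av (ext g) x
      map_add' := by
        intro a b; funext x
        simp only [ext_add, av_add, Pi.add_apply]; ring
      map_smul' := by
        intro c a; funext x
        simp only [ext_smul, av_smul, Pi.smul_apply, RingHom.id_apply, smul_eq_mul]; ring }
  have key : ∀ g : S → ℝ, T g = 0 → ∀ x ∈ S, ext g x ≤ 0 := by
    intro g hg
    apply max_principle hd S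
    · intro x hx
      have := congrFun hg ⟨x, hx⟩
      simp only [T, LinearMap.coe_mk, AddHom.coe_mk, Pi.zero_apply] at this
      simp only [ext, hx, dite_true] at this ⊢
      linarith
    · intro x hx j hj
      simp [ext, hj]
  have hinj : Function.Injective T := by
    rw [injective_iff_map_eq_zero]
    intro g hg
    funext x
    have h1 := key g hg x x.2
    have h2 := key (-g) (by rw [map_neg, hg, neg_zero]) x x.2
    simp [ext] at h1 h2
    exact le_antisymm h1 h2
  have hsurj : Function.Surjective T := LinearMap.injective_iff_surjective.mp hinj
  let f0 : Zd d → ℝ := fun x => if x ∈ S then 0 else f x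
  obtain ⟨g, hg⟩ := hsurj fun x => av f0 x
  refine ⟨fun v => ext g v + f0 v, ?_, ?_⟩
  · intro x hx; simp [ext, f0, hx]
  · intro x hx
    rw [av_add]
    have := congrFun hg ⟨x, hx⟩
    simp only [T, LinearMap.coe_mk, AddHom.coe_mk] at this
    have e1 : ext g x = g ⟨x, hx⟩ := by simp [ext, hx]
    have e2 : f0 x = 0 := by simp [f0, hx]
    show ext g x + f0 x = _
    rw [e1, e2]; linarith

/-- squared Euclidean norm -/
noncomputable def nsq {d : ℕ} (x : Zd d) : ℝ := ∑ i, ((x i : ℝ)) ^ 2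

/-- inner product with a direction -/
noncomputable def ip {d : ℕ} (x : Zd d) (j : Fin d × Bool) : ℝ :=
  (if j.2 then 1 else -1) * (x j.1 : ℝ)

lemma nsq_add_u {d : ℕ} (x : Zd d) (j : Fin d × Bool) :
    nsq (x + u j) = nsq x + (1 + 2 * ip x j) := by
  rcases j with ⟨i, b⟩
  have : ∀ k, (((x + u (i, b)) k : ℤ) : ℝ) ^ 2 =
      ((x k : ℝ)) ^ 2 + (if k = i then 1 + 2 * ip x (i, b) else 0) := by
    intro k
    by_cases h : k = i
    · subst h
      cases b <;> simp [u, ip] <;> ring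
    · simp [u, h]
  simp only [nsq, this, Finset.sum_add_distrib]
  simp

lemma sq_le_nsq {d : ℕ} (x : Zd d) (i : Fin d) : (x i : ℝ) ^ 2 ≤ nsq x :=
  Finset.single_le_sum (f := fun i => ((x i : ℝ)) ^ 2) (fun i _ => sq_nonneg _) (Finset.mem_univ i)

lemma nsq_nonneg {d : ℕ} (x : Zd d) : 0 ≤ nsq x := Finset.sum_nonneg fun i _ => sq_nonneg _

lemma ip_sq {d : ℕ} (x : Zd d) (j) : ip x j ^ 2 = (x j.1 : ℝ) ^ 2 := by
  unfold ip; split_ifs <;> ring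

lemma abs_ip_le {d : ℕ} (x : Zd d) (j) {R : ℝ} (hR : 0 ≤ R) (h : nsq x ≤ R ^ 2) : |ip x j| ≤ R := by
  apply abs_le_of_sq_le_sq _ hR
  rw [ip_sq]; exact (sq_le_nsq x _).trans h

lemma sum_ip {d : ℕ} (x : Zd d) : ∑ j, ip x j = 0 := by
  have : ∀ j, ip x (opp j) = - ip x j := by
    rintro ⟨i, b⟩; cases b <;> simp [ip, opp]
  have h := sum_opp (ip x)
  simp only [this, Finset.sum_neg_distrib] at h
  linarith

lemma sum_ip_sq {d : ℕ} (x : Zd d) : ∑ j, ip x j ^ 2 = 2 * nsq x := by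
  simp only [ip_sq]
  rw [Fintype.sum_prod_type]
  simp [nsq, Finset.mul_sum]

end Pf

namespace Pf

/-- algebraic core of the gradient estimate -/
lemma grad_alg {d : ℕ} (r : Fin d × Bool → ℝ) (hpos : ∀ j, 0 < r j)
    (hsum : ∑ j, r j = 2 * d) :
    (∑ j, (r j - 1) ^ 2) ^ 2 ≤ 320 * (d : ℝ) ^ 3 * ∑ j, (1 - r j * r (opp j)) ^ 2 := by
  have hle : ∀ j, r j ≤ 2 * d := by
    intro j; rw [← hsum]
    exact Finset.single_le_sum (f := r) (fun j _ => (hpos j).le) (Finset.mem_univ j)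
  set s : Fin d × Bool → ℝ := fun j => Real.sqrt (r j) with hs
  have hs2 : ∀ j, s j ^ 2 = r j := fun j => Real.sq_sqrt (hpos j).le
  have hs0 : ∀ j, 0 < s j := fun j => Real.sqrt_pos.mpr (hpos j)
  set A := ∑ j, (s j - s (opp j)) ^ 2 with hA
  set Q := ∑ j, (1 - s j * s (opp j)) ^ 2 with hQ
  have hA0 : 0 ≤ A := Finset.sum_nonneg fun _ _ => sq_nonneg _
  have hQ0 : 0 ≤ Q := Finset.sum_nonneg fun _ _ => sq_nonneg _
  have hA1 : A = 2 * ∑ j, (1 - s j * s (opp j)) := by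
    have h1 : A = ∑ j, r j + ∑ j, r (opp j) - 2 * ∑ j, s j * s (opp j) := by
      rw [hA, Finset.mul_sum, ← Finset.sum_add_distrib, ← Finset.sum_sub_distrib]
      refine Finset.sum_congr rfl fun j _ => ?_
      rw [← hs2, ← hs2 (opp j)]; ring
    rw [h1, sum_opp, hsum, Finset.sum_sub_distrib, Finset.sum_const, card_dir]
    push_cast; simp; ring
  have hA2 : A ^ 2 ≤ 8 * d * Q := by
    have h := sq_sum_le_card_mul_sum_sq (s := (Finset.univ : Finset (Fin d × Bool)))
      (f := fun j => 1 - s j * s (opp j))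
    rw [card_dir] at h
    push_cast at h
    rw [hA1, mul_pow]
    calc (2 : ℝ) ^ 2 * (∑ j, (1 - s j * s (opp j))) ^ 2 ≤ 2 ^ 2 * (2 * d * Q) := by gcongr
      _ = _ := by ring
  have hst : ∀ j, s j * s (opp j) ≤ 2 * d := by
    intro j
    have h1 := hle j; have h2 := hle (opp j)
    rw [← hs2] at h1 h2
    nlinarith [sq_nonneg (s j - s (opp j))]
  have hd0 : (0 : ℝ) ≤ d := by positivity
  by_cases hd : d = 0
  · subst hd; simp
  have hd1 : (1 : ℝ) ≤ d := by exact_mod_cast Nat.one_le_iff_ne_zero.mpr hd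
  have hQb : Q ≤ 8 * (d : ℝ) ^ 3 := by
    calc Q ≤ ∑ j : Fin d × Bool, (2 * (d : ℝ)) ^ 2 := by
          refine Finset.sum_le_sum fun j _ => ?_
          have h0 := mul_pos (hs0 j) (hs0 (opp j))
          apply sq_le_sq'
          · linarith [hst j]
          · linarith
      _ = _ := by rw [Finset.sum_const, card_dir]; push_cast; simp; ring
  have hPhi : ∑ j, (r j - 1) ^ 2 ≤ 4 * d * A + 2 * Q := by
    rw [hA, hQ, Finset.mul_sum, Finset.mul_sum, ← Finset.sum_add_distrib]
    refine Finset.sum_le_sum fun j _ => ?_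
    have e : r j - 1 = s j * (s j - s (opp j)) + (s j * s (opp j) - 1) := by
      rw [← hs2 j]; ring
    have h1 : s j ^ 2 * (s j - s (opp j)) ^ 2 ≤ 2 * d * (s j - s (opp j)) ^ 2 := by
      rw [hs2]; exact mul_le_mul_of_nonneg_right (hle j) (sq_nonneg _)
    rw [e]
    nlinarith [sq_nonneg (s j * (s j - s (opp j)) - (s j * s (opp j) - 1))]
  have hPhi0 : 0 ≤ ∑ j, (r j - 1) ^ 2 := Finset.sum_nonneg fun _ _ => sq_nonneg _
  have hQP : Q ≤ ∑ j, (1 - r j * r (opp j)) ^ 2 := by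
    refine Finset.sum_le_sum fun j _ => ?_
    rw [← hs2 j, ← hs2 (opp j)]
    have h0 := mul_pos (hs0 j) (hs0 (opp j))
    have : (1 - s j ^ 2 * s (opp j) ^ 2) ^ 2 =
        (1 - s j * s (opp j)) ^ 2 * (1 + s j * s (opp j)) ^ 2 := by ring
    rw [this]
    have h1 : 1 ≤ (1 + s j * s (opp j)) ^ 2 := by nlinarith
    exact le_mul_of_one_le_right (sq_nonneg _) h1
  calc (∑ j, (r j - 1) ^ 2) ^ 2 ≤ (4 * d * A + 2 * Q) ^ 2 := by gcongr
    _ ≤ 32 * d ^ 2 * A ^ 2 + 8 * Q ^ 2 := by nlinarith [sq_nonneg (4 * d * A - 2 * Q)]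
    _ ≤ 32 * d ^ 2 * (8 * d * Q) + 8 * (8 * d ^ 3 * Q) := by
        have : Q ^ 2 ≤ 8 * d ^ 3 * Q := by rw [sq]; gcongr
        gcongr
    _ = 320 * d ^ 3 * Q := by ring
    _ ≤ _ := by gcongr

/-- sup-norm box -/
def bx {d : ℕ} (N : ℤ) : Set (Zd d) := {x | ∀ i, |x i| ≤ N}

lemma bx_add_u {d : ℕ} {N : ℤ} {x : Zd d} (hx : x ∈ bx N) (j) : x + u j ∈ bx (N + 1) := by
  intro i
  have h := hx i
  have h2 : |u j i| ≤ 1 := by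
    rcases j with ⟨k, b⟩
    by_cases hk : i = k
    · subst hk; cases b <;> simp [u]
    · simp [u, hk]
  calc |(x + u j) i| ≤ |x i| + |u j i| := abs_add_le _ _
    _ ≤ _ := by linarith

lemma bx_mono {d : ℕ} {N M : ℤ} (h : N ≤ M) : (bx N : Set (Zd d)) ⊆ bx M :=
  fun _ hx i => (hx i).trans h

lemma bx_finite {d : ℕ} (N : ℤ) : (bx N : Set (Zd d)).Finite := by
  have : (bx N : Set (Zd d)) ⊆ Set.Icc (fun _ => -N) (fun _ => N) := by
    intro x hx
    exact ⟨fun i => (abs_le.mp (hx i)).1, fun i => (abs_le.mp (hx i)).2⟩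
  exact (Set.finite_Icc _ _).subset this

lemma mem_bx_of_nsq {d : ℕ} {R : ℕ} {x : Zd d} (h : nsq x ≤ (R : ℝ) ^ 2) : x ∈ bx (R : ℤ) := by
  intro i
  have h1 := (sq_le_nsq x i).trans h
  have : |(x i : ℝ)| ≤ R := abs_le_of_sq_le_sq h1 (by positivity)
  exact_mod_cast this

noncomputable def rr {d : ℕ} (H : Zd d → ℝ) (x : Zd d) (j : Fin d × Bool) : ℝ := H (x + u j) / H x

noncomputable def Phi {d : ℕ} (H : Zd d → ℝ) (x : Zd d) : ℝ := ∑ j, (rr H x j - 1) ^ 2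

lemma Phi_nonneg {d : ℕ} (H : Zd d → ℝ) (x : Zd d) : 0 ≤ Phi H x :=
  Finset.sum_nonneg fun _ _ => sq_nonneg _

lemma rr_pos {d : ℕ} {H : Zd d → ℝ} (hH : ∀ x, 0 < H x) (x j) : 0 < rr H x j :=
  div_pos (hH _) (hH _)

lemma sum_of_harm {d : ℕ} (hd : 0 < d) {H : Zd d → ℝ} {x : Zd d} (h : H x = av H x) :
    ∑ j, H (x + u j) = 2 * d * H x := by
  have : (d : ℝ) ≠ 0 := by positivity
  rw [h]; unfold av; field_simp

lemma rr_sum {d : ℕ} (hd : 0 < d) {H : Zd d → ℝ} (hH : ∀ x, 0 < H x) {x : Zd d}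
    (h : H x = av H x) : ∑ j, rr H x j = 2 * d := by
  unfold rr
  rw [← Finset.sum_div, sum_of_harm hd h]
  field_simp [(hH x).ne']

lemma rr_le {d : ℕ} (hd : 0 < d) {H : Zd d → ℝ} (hH : ∀ x, 0 < H x) {x : Zd d}
    (h : H x = av H x) (j) : rr H x j ≤ 2 * d := by
  rw [← rr_sum hd hH h]
  exact Finset.single_le_sum (f := rr H x) (fun j _ => (rr_pos hH x j).le) (Finset.mem_univ j)

lemma Phi_le {d : ℕ} (hd : 0 < d) {H : Zd d → ℝ} (hH : ∀ x, 0 < H x) {x : Zd d}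
    (h : H x = av H x) : Phi H x ≤ 8 * (d : ℝ) ^ 3 := by
  have hd1 : (1 : ℝ) ≤ d := by exact_mod_cast hd
  calc Phi H x ≤ ∑ j : Fin d × Bool, (2 * (d : ℝ)) ^ 2 := by
        refine Finset.sum_le_sum fun j _ => ?_
        have h0 := rr_pos hH x j
        have h1 := rr_le hd hH h j
        apply sq_le_sq' <;> linarith
    _ = _ := by rw [Finset.sum_const, card_dir]; push_cast; simp; ring

/-- Bochner type inequality -/
lemma bochner {d : ℕ} (hd : 0 < d) {H : Zd d → ℝ} (hH : ∀ x, 0 < H x) {x : Zd d}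
    (h : H x = av H x) (hn : ∀ j, H (x + u j) = av H (x + u j)) :
    Phi H x ^ 2 ≤ 640 * (d : ℝ) ^ 4 * ∑ k, rr H x k * (Phi H (x + u k) - Phi H x) := by
  have hx := (hH x).ne'
  have hd0 : (0 : ℝ) < d := by positivity
  have h2 : ∀ j, ∑ k, rr H x k * (rr H (x + u k) j - rr H x j) = 0 := by
    intro j
    have e : ∀ k, rr H x k * (rr H (x + u k) j - rr H x j) =
        H (x + u j + u k) / H x - rr H x k * rr H x j := by
      intro k
      have := (hH (x + u k)).ne'
      rw [mul_sub]
      congr 1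
      unfold rr
      rw [add_right_comm x (u k) (u j)]
      field_simp
    simp only [e]
    rw [Finset.sum_sub_distrib, ← Finset.sum_mul, rr_sum hd hH h, ← Finset.sum_div,
      sum_of_harm hd (hn j)]
    unfold rr; field_simp; ring
  have h3 : ∑ k, rr H x k * (Phi H (x + u k) - Phi H x) =
      ∑ j, ∑ k, rr H x k * (rr H (x + u k) j - rr H x j) ^ 2 := by
    have e : ∀ k, rr H x k * (Phi H (x + u k) - Phi H x) =
        ∑ j, (rr H x k * (rr H (x + u k) j - rr H x j) ^ 2 +
          2 * (rr H x j - 1) * (rr H x k * (rr H (x + u k) j - rr H x j))) := by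
      intro k
      unfold Phi
      rw [← Finset.sum_sub_distrib, Finset.mul_sum]
      refine Finset.sum_congr rfl fun j _ => ?_
      ring
    simp only [e]
    rw [Finset.sum_comm]
    refine Finset.sum_congr rfl fun j _ => ?_
    rw [Finset.sum_add_distrib, ← Finset.mul_sum, h2 j]; ring
  have h4 : (2 * (d : ℝ))⁻¹ * ∑ j, (1 - rr H x j * rr H x (opp j)) ^ 2 ≤
      ∑ j, ∑ k, rr H x k * (rr H (x + u k) j - rr H x j) ^ 2 := by
    rw [Finset.mul_sum]
    refine Finset.sum_le_sum fun j _ => ?_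
    have hp := rr_pos hH x (opp j)
    have hl := rr_le hd hH h (opp j)
    have e1 : rr H (x + u (opp j)) j = (rr H x (opp j))⁻¹ := by
      unfold rr
      rw [u_opp, inv_div]
      congr 2
      abel
    calc (2 * (d : ℝ))⁻¹ * (1 - rr H x j * rr H x (opp j)) ^ 2
        ≤ (rr H x (opp j))⁻¹ * (1 - rr H x j * rr H x (opp j)) ^ 2 := by gcongr
      _ = rr H x (opp j) * (rr H (x + u (opp j)) j - rr H x j) ^ 2 := by
          rw [e1]; field_simp
      _ ≤ _ := Finset.single_le_sum
          (f := fun k => rr H x k * (rr H (x + u k) j - rr H x j) ^ 2)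
          (fun k _ => mul_nonneg (rr_pos hH x k).le (sq_nonneg _)) (Finset.mem_univ _)
  have h5 := grad_alg (rr H x) (rr_pos hH x) (rr_sum hd hH h)
  rw [h3]
  calc Phi H x ^ 2 ≤ _ := h5
    _ = 640 * (d : ℝ) ^ 4 * ((2 * (d : ℝ))⁻¹ * ∑ j, (1 - rr H x j * rr H x (opp j)) ^ 2) := by
        field_simp; ring
    _ ≤ _ := by gcongr

lemma inv_sq_bd {a : ℝ} (h : |a| ≤ 1 / 2) : 1 ≤ (1 + 2 * a + 16 * a ^ 2) * (1 - a) ^ 2 := by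
  obtain ⟨h1, h2⟩ := abs_le.mp h
  have e : (1 + 2 * a + 16 * a ^ 2) * (1 - a) ^ 2 - 1 = a ^ 2 * (16 * (1 - a) ^ 2 - 3 + 2 * a) := by
    ring
  have : 0 ≤ a ^ 2 * (16 * (1 - a) ^ 2 - 3 + 2 * a) := by
    apply mul_nonneg (sq_nonneg _); nlinarith
  linarith

/-- the gradient estimate -/
lemma gradient {d : ℕ} (hd : 0 < d) : ∃ C : ℝ, 0 < C ∧ ∀ (R : ℕ), 1 ≤ R → ∀ H : Zd d → ℝ,
    (∀ x, 0 < H x) → (∀ x ∈ bx ((R : ℤ) + 1), H x = av H x) →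
    ∀ x, nsq x < (R : ℝ) ^ 2 → ((R : ℝ) ^ 2 - nsq x) ^ 2 * Phi H x ≤ C * (R : ℝ) ^ 2 := by
  have hd1 : (1 : ℝ) ≤ d := by exact_mod_cast hd
  set c : ℝ := 640 * (d : ℝ) ^ 4 with hc
  have hc0 : 0 < c := by positivity
  refine ⟨288 * (d : ℝ) ^ 3 + 2 * c * (292 * d) + 32 * c ^ 2 * d, by positivity, ?_⟩
  intro R hR H hH hharm
  have hR1 : (1 : ℝ) ≤ R := by exact_mod_cast hR
  set B : Set (Zd d) := {x | nsq x < (R : ℝ) ^ 2} with hB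
  have hBbx : B ⊆ bx (R : ℤ) := fun x hx => mem_bx_of_nsq (le_of_lt hx)
  have hBfin : B.Finite := (bx_finite _).subset hBbx
  have hharmB : ∀ x ∈ B, H x = av H x := fun x hx => hharm x (bx_mono (by omega) (hBbx hx))
  have hharmB' : ∀ x ∈ B, ∀ j, H (x + u j) = av H (x + u j) :=
    fun x hx j => hharm _ (bx_add_u (hBbx hx) j)
  set w : Zd d → ℝ := fun x => (R : ℝ) ^ 2 - nsq x with hw
  have h0B : (0 : Zd d) ∈ B := by
    show nsq 0 < _
    simp [nsq]; positivity
  obtain ⟨x0, hx0, hmax⟩ := hBfin.exists_maximalFor (fun x => w x ^ 2 * Phi H x) B ⟨0, h0B⟩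
  have hmax' : ∀ x ∈ B, w x ^ 2 * Phi H x ≤ w x0 ^ 2 * Phi H x0 := by
    intro x hx
    by_contra hlt
    push Not at hlt
    exact absurd (hmax hx hlt.le) (not_le.mpr hlt)
  intro x hx
  refine (hmax' x hx).trans ?_
  clear hx x
  have hwpos : 0 < w x0 := sub_pos.mpr hx0
  have hwR : w x0 ≤ (R : ℝ) ^ 2 := by simp only [hw]; linarith [nsq_nonneg x0]
  have hPhib := Phi_le hd hH (hharmB x0 hx0)
  have hPhi0 := Phi_nonneg H x0
  by_cases hcase : w x0 < 4 * R + 2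
  · have : w x0 ≤ 6 * R := by linarith
    calc w x0 ^ 2 * Phi H x0 ≤ (6 * R) ^ 2 * (8 * (d : ℝ) ^ 3) := by gcongr
      _ = 288 * (d : ℝ) ^ 3 * (R : ℝ) ^ 2 := by ring
      _ ≤ _ := by
        apply mul_le_mul_of_nonneg_right _ (by positivity)
        have : 0 ≤ 2 * c * (292 * d) := by positivity
        have : 0 ≤ 32 * c ^ 2 * d := by positivity
        linarith
  push Not at hcase
  have hw0 := hwpos.ne'
  set a : Fin d × Bool → ℝ := fun k => (1 + 2 * ip x0 k) / w x0 with ha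
  have hip : ∀ k, |ip x0 k| ≤ R := fun k => abs_ip_le x0 k (by positivity) (le_of_lt hx0)
  have hnum : ∀ k, |1 + 2 * ip x0 k| ≤ 2 * R + 1 := by
    intro k
    have := abs_le.mp (hip k)
    rw [abs_le]; constructor <;> linarith
  have haw : ∀ k, a k * w x0 = 1 + 2 * ip x0 k := fun k => div_mul_cancel₀ _ hw0
  have habs : ∀ k, |a k| ≤ 1 / 2 := by
    intro k
    simp only [ha]
    rw [abs_div, abs_of_pos hwpos, div_le_iff₀ hwpos]
    linarith [hnum k]
  have hwk : ∀ k, w (x0 + u k) = w x0 * (1 - a k) := by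
    intro k
    have := haw k
    simp only [hw] at this ⊢
    rw [nsq_add_u]; linarith
  have hPk : ∀ k, Phi H (x0 + u k) ≤ Phi H x0 * (1 + 2 * a k + 16 * a k ^ 2) := by
    intro k
    have h1 : 0 < 1 - a k := by linarith [(abs_le.mp (habs k)).2]
    have hmem : x0 + u k ∈ B := by
      have : 0 < w (x0 + u k) := by rw [hwk]; positivity
      exact sub_pos.mp this
    have h2 := hmax' _ hmem
    rw [hwk, mul_pow, mul_assoc] at h2
    have h3 : (1 - a k) ^ 2 * Phi H (x0 + u k) ≤ Phi H x0 :=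
      le_of_mul_le_mul_left h2 (by positivity)
    have h4 := inv_sq_bd (habs k)
    have h5 := Phi_nonneg H (x0 + u k)
    have h6 : 0 ≤ 1 + 2 * a k + 16 * a k ^ 2 := by nlinarith [sq_nonneg (1 + 16 * a k)]
    calc Phi H (x0 + u k) = 1 * Phi H (x0 + u k) := by ring
      _ ≤ ((1 + 2 * a k + 16 * a k ^ 2) * (1 - a k) ^ 2) * Phi H (x0 + u k) := by gcongr
      _ = (1 + 2 * a k + 16 * a k ^ 2) * ((1 - a k) ^ 2 * Phi H (x0 + u k)) := by ring
      _ ≤ (1 + 2 * a k + 16 * a k ^ 2) * Phi H x0 := by gcongr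
      _ = _ := by ring
  have hboch := bochner hd hH (hharmB x0 hx0) (hharmB' x0 hx0)
  set T := w x0 ^ 2 * Phi H x0 with hT
  rcases hPhi0.eq_or_lt with hz | hPpos
  · rw [hT, ← hz]; simp; positivity
  have hrs := rr_sum hd hH (hharmB x0 hx0)
  have hS : Phi H x0 ≤ c * ∑ k, rr H x0 k * (2 * a k + 16 * a k ^ 2) := by
    have : Phi H x0 * Phi H x0 ≤ Phi H x0 * (c * ∑ k, rr H x0 k * (2 * a k + 16 * a k ^ 2)) := by
      rw [← sq]
      refine hboch.trans ?_
      rw [mul_left_comm, Finset.mul_sum _ _ (Phi H x0)]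
      refine mul_le_mul_of_nonneg_left (Finset.sum_le_sum fun k _ => ?_) hc0.le
      rw [mul_left_comm]
      refine mul_le_mul_of_nonneg_left ?_ (rr_pos hH x0 k).le
      linarith [hPk k]
    exact le_of_mul_le_mul_left this hPpos
  -- first order term
  set V := ∑ k, |rr H x0 k - 1| with hV
  have hV0 : 0 ≤ V := Finset.sum_nonneg fun _ _ => abs_nonneg _
  have hVsq : V ^ 2 ≤ 2 * d * Phi H x0 := by
    have h := sq_sum_le_card_mul_sum_sq (s := (Finset.univ : Finset (Fin d × Bool)))
      (f := fun k => |rr H x0 k - 1|)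
    rw [card_dir] at h
    simp only [sq_abs] at h
    push_cast at h
    exact h
  have h1 : (∑ k, rr H x0 k * a k) * w x0 ≤ 2 * d + 2 * R * V := by
    have e : (∑ k, rr H x0 k * a k) * w x0 = 2 * d + 2 * ∑ k, (rr H x0 k - 1) * ip x0 k := by
      rw [Finset.sum_mul]
      simp only [mul_assoc, haw]
      have : ∀ k, rr H x0 k * (1 + 2 * ip x0 k) =
          rr H x0 k + (2 * ((rr H x0 k - 1) * ip x0 k) + 2 * ip x0 k) := by intro k; ring
      simp only [this]
      rw [Finset.sum_add_distrib, Finset.sum_add_distrib, hrs, ← Finset.mul_sum,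
        ← Finset.mul_sum, sum_ip]
      ring
    have : ∑ k, (rr H x0 k - 1) * ip x0 k ≤ V * R := by
      rw [hV, Finset.sum_mul]
      refine Finset.sum_le_sum fun k _ => ?_
      calc _ ≤ |(rr H x0 k - 1) * ip x0 k| := le_abs_self _
        _ = |rr H x0 k - 1| * |ip x0 k| := abs_mul _ _
        _ ≤ _ := by gcongr; exact hip k
    rw [e]; linarith
  have h2 : (∑ k, rr H x0 k * a k ^ 2) * w x0 ^ 2 ≤ 18 * d * R ^ 2 := by
    have e : ∀ k, rr H x0 k * a k ^ 2 * w x0 ^ 2 ≤ rr H x0 k * (9 * R ^ 2) := by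
      intro k
      rw [mul_assoc, ← mul_pow, haw]
      refine mul_le_mul_of_nonneg_left ?_ (rr_pos hH x0 k).le
      have : (1 + 2 * ip x0 k) ^ 2 ≤ (3 * R : ℝ) ^ 2 := by
        apply sq_le_sq'
        · linarith [(abs_le.mp (hnum k)).1]
        · linarith [(abs_le.mp (hnum k)).2]
      linarith
    rw [Finset.sum_mul]
    refine (Finset.sum_le_sum fun k _ => e k).trans ?_
    rw [← Finset.sum_mul, hrs]; linarith
  have hT1 : T ≤ c * (292 * d * R ^ 2 + 4 * R * (V * w x0)) := by
    have e : ∑ k, rr H x0 k * (2 * a k + 16 * a k ^ 2) =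
        2 * ∑ k, rr H x0 k * a k + 16 * ∑ k, rr H x0 k * a k ^ 2 := by
      rw [Finset.mul_sum, Finset.mul_sum, ← Finset.sum_add_distrib]
      exact Finset.sum_congr rfl fun k _ => by ring
    rw [e] at hS
    calc T ≤ w x0 ^ 2 * (c * (2 * ∑ k, rr H x0 k * a k + 16 * ∑ k, rr H x0 k * a k ^ 2)) := by
          rw [hT]; gcongr
      _ = c * (2 * w x0 * ((∑ k, rr H x0 k * a k) * w x0) +
            16 * ((∑ k, rr H x0 k * a k ^ 2) * w x0 ^ 2)) := by ring
      _ ≤ c * (2 * w x0 * (2 * d + 2 * R * V) + 16 * (18 * d * R ^ 2)) := by gcongr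
      _ ≤ c * (292 * d * R ^ 2 + 4 * R * (V * w x0)) := by
          apply mul_le_mul_of_nonneg_left _ hc0.le
          nlinarith
  have hVw : (V * w x0) ^ 2 ≤ 2 * d * T := by
    rw [mul_pow, hT]; nlinarith [sq_nonneg (w x0)]
  have hT0 : 0 ≤ T := by positivity
  -- AM-GM
  have hAG : c * (4 * R * (V * w x0)) ≤ T / 2 + 16 * c ^ 2 * d * R ^ 2 := by
    have h : (c * (4 * R * (V * w x0))) ^ 2 ≤ (T / 2 + 16 * c ^ 2 * d * R ^ 2) ^ 2 := by
      calc (c * (4 * R * (V * w x0))) ^ 2 = 16 * c ^ 2 * R ^ 2 * (V * w x0) ^ 2 := by ring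
        _ ≤ 16 * c ^ 2 * R ^ 2 * (2 * d * T) := by gcongr
        _ ≤ _ := by nlinarith [sq_nonneg (T / 2 - 16 * c ^ 2 * d * R ^ 2)]
    exact (abs_le_of_sq_le_sq h (by positivity)).trans' (le_abs_self _)
  have : 0 ≤ 288 * (d : ℝ) ^ 3 * R ^ 2 := by positivity
  nlinarith

end Pf

namespace Pf

lemma bern {h : ℝ} (hh : |h| ≤ 1 / 20) :
    (1 + h) ^ (-(1 / 4) : ℝ) ≤ 1 - h / 4 + 3 * h ^ 2 / 16 := by
  obtain ⟨h1, h2⟩ := abs_le.mp hh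
  have hp : 0 < 1 + h := by linarith
  set y := (1 + h) ^ (-(1 / 4) : ℝ) with hy
  have hy0 : 0 < y := Real.rpow_pos_of_pos hp _
  have hy4 : y ^ 4 * (1 + h) = 1 := by
    rw [hy, ← Real.rpow_natCast, ← Real.rpow_mul hp.le]
    norm_num
    rw [Real.rpow_neg_one]
    exact inv_mul_cancel₀ hp.ne'
  set q := 1 - h / 4 + 3 * h ^ 2 / 16 with hq
  have hq0 : 0 < q := by rw [hq]; nlinarith [sq_nonneg h]
  have hh2 := sq_nonneg h
  have h3 : h * h ^ 2 ≤ 1 / 20 * h ^ 2 := mul_le_mul_of_nonneg_right h2 hh2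
  have h3' : -(1 / 20) * h ^ 2 ≤ h * h ^ 2 := mul_le_mul_of_nonneg_right h1 hh2
  have hm : 1 - h / 2 + 43 / 100 * h ^ 2 ≤ q ^ 2 := by
    rw [hq]; nlinarith [sq_nonneg (h ^ 2)]
  have hm0 : 0 < 1 - h / 2 + 43 / 100 * h ^ 2 := by nlinarith
  have hm2 : 1 - h + 108 / 100 * h ^ 2 ≤ (1 - h / 2 + 43 / 100 * h ^ 2) ^ 2 := by
    nlinarith [sq_nonneg (h ^ 2)]
  have hq4 : 1 - h + 108 / 100 * h ^ 2 ≤ q ^ 4 := by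
    calc _ ≤ _ := hm2
      _ ≤ (q ^ 2) ^ 2 := by gcongr
      _ = q ^ 4 := by ring
  have hfin : 1 ≤ q ^ 4 * (1 + h) := by
    calc 1 ≤ (1 - h + 108 / 100 * h ^ 2) * (1 + h) := by nlinarith
      _ ≤ _ := by gcongr
  by_contra hlt
  push Not at hlt
  have : q ^ 4 < y ^ 4 := by gcongr
  nlinarith

/-- barrier -/
noncomputable def bar {d : ℕ} (x : Zd d) : ℝ := (nsq x + 500) ^ (-(1 / 4) : ℝ)

lemma bar_pos {d : ℕ} (x : Zd d) : 0 < bar x :=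
  Real.rpow_pos_of_pos (by linarith [nsq_nonneg x]) _

lemma bar_anti {d : ℕ} {x y : Zd d} (h : nsq x ≤ nsq y) : bar y ≤ bar x :=
  Real.rpow_le_rpow_of_nonpos (by linarith [nsq_nonneg x]) (by linarith) (by norm_num)

lemma bar_super {d : ℕ} (hd : 3 ≤ d) (x : Zd d) : av bar x ≤ bar x := by
  have hd3 : (3 : ℝ) ≤ d := by exact_mod_cast hd
  have hn := nsq_nonneg x
  set t := nsq x + 500 with ht
  have ht0 : 0 < t := by linarith
  set h : Fin d × Bool → ℝ := fun j => (1 + 2 * ip x j) / t with hh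
  have hht : ∀ j, h j * t = 1 + 2 * ip x j := fun j => div_mul_cancel₀ _ ht0.ne'
  have habs : ∀ j, |h j| ≤ 1 / 20 := by
    intro j
    have h1 : ip x j ^ 2 ≤ nsq x := by rw [ip_sq]; exact sq_le_nsq x _
    simp only [hh]
    rw [abs_div, abs_of_pos ht0, div_le_iff₀ ht0, abs_le]
    constructor <;> nlinarith [sq_nonneg (ip x j - 20), sq_nonneg (ip x j + 20)]
  have hF : bar x = t ^ (-(1 / 4) : ℝ) := rfl
  have hF0 := bar_pos x
  have hj : ∀ j, bar (x + u j) ≤ bar x * (1 - h j / 4 + 3 * h j ^ 2 / 16) := by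
    intro j
    have h1 : 0 < 1 + h j := by linarith [(abs_le.mp (habs j)).1]
    have e : nsq (x + u j) + 500 = t * (1 + h j) := by
      rw [nsq_add_u]; linarith [hht j]
    unfold bar
    rw [e, Real.mul_rpow ht0.le h1.le, ← ht]
    exact mul_le_mul_of_nonneg_left (bern (habs j)) hF0.le
  have hs1 : (∑ j, h j) * t = 2 * d := by
    rw [Finset.sum_mul]; simp only [hht]
    rw [Finset.sum_add_distrib, ← Finset.mul_sum, sum_ip, Finset.sum_const, card_dir]; simp
  have hs2 : (∑ j, h j ^ 2) * t ^ 2 = 2 * d + 8 * nsq x := by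
    rw [Finset.sum_mul]; simp only [← mul_pow, hht]
    have : ∀ j, (1 + 2 * ip x j) ^ 2 = 1 + (4 * ip x j + 4 * ip x j ^ 2) := by intro j; ring
    simp only [this]
    rw [Finset.sum_add_distrib, Finset.sum_add_distrib, ← Finset.mul_sum, ← Finset.mul_sum,
      sum_ip, sum_ip_sq, Finset.sum_const, card_dir]
    simp; ring
  have hS : ∑ j, (1 - h j / 4 + 3 * h j ^ 2 / 16) ≤ 2 * (d : ℝ) := by
    have e : ∑ j, (1 - h j / 4 + 3 * h j ^ 2 / 16) =
        2 * d - (∑ j, h j) / 4 + 3 / 16 * ∑ j, h j ^ 2 := by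
      rw [Finset.sum_add_distrib, Finset.sum_sub_distrib, Finset.sum_const, card_dir,
        Finset.sum_div, Finset.mul_sum]
      congr 1
      · simp
      · exact Finset.sum_congr rfl fun j _ => by ring
    rw [e]
    have : 3 / 16 * (∑ j, h j ^ 2) ≤ (∑ j, h j) / 4 := by
      have h2 : (3 / 16 * (∑ j, h j ^ 2)) * t ^ 2 ≤ ((∑ j, h j) / 4) * t ^ 2 := by
        have e1 : (3 / 16 * (∑ j, h j ^ 2)) * t ^ 2 = 3 / 16 * (2 * d + 8 * nsq x) := by
          rw [← hs2]; ring
        have e2 : ((∑ j, h j) / 4) * t ^ 2 = (2 * d) * t / 4 := by rw [← hs1]; ring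
        rw [e1, e2, ht]; nlinarith
      exact le_of_mul_le_mul_right h2 (by positivity)
    linarith
  unfold av
  rw [inv_mul_le_iff₀ (by positivity)]
  calc ∑ j, bar (x + u j) ≤ ∑ j, bar x * (1 - h j / 4 + 3 * h j ^ 2 / 16) :=
        Finset.sum_le_sum fun j _ => hj j
    _ = bar x * ∑ j, (1 - h j / 4 + 3 * h j ^ 2 / 16) := by rw [Finset.mul_sum]
    _ ≤ bar x * (2 * d) := by gcongr
    _ = _ := by ring

lemma bar_strict {d : ℕ} (hd : 3 ≤ d) : av (bar (d := d)) 0 < bar (0 : Zd d) := by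
  have h : ∀ j, bar ((0 : Zd d) + u j) = (501 : ℝ) ^ (-(1 / 4) : ℝ) := by
    intro j
    unfold bar
    rw [nsq_add_u]
    have : nsq (0 : Zd d) = 0 := by simp [nsq]
    have h2 : ip (0 : Zd d) j = 0 := by simp [ip]
    rw [this, h2]; norm_num
  rw [av_congr (g := fun _ => (501 : ℝ) ^ (-(1 / 4) : ℝ)) 0 h, av_const (by omega)]
  unfold bar
  have : nsq (0 : Zd d) = 0 := by simp [nsq]
  rw [this]
  exact Real.rpow_lt_rpow_of_neg (by norm_num) (by norm_num) (by norm_num)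

lemma av_shift {d : ℕ} (f : Zd d → ℝ) (z x : Zd d) :
    av (fun v => f (v - z)) x = av f (x - z) := by
  unfold av
  congr 1
  refine Finset.sum_congr rfl fun j _ => ?_
  exact congrArg f (by abel)

lemma av_shift' {d : ℕ} (f : Zd d → ℝ) (z x : Zd d) :
    av (fun v => f (z + v)) x = av f (z + x) := by
  unfold av
  congr 1
  refine Finset.sum_congr rfl fun j _ => ?_
  exact congrArg f (by abel)

lemma nsq_le_of_bx {d : ℕ} {M : ℤ} {x : Zd d} (h : x ∈ bx M) : nsq x ≤ d * (M : ℝ) ^ 2 := by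
  unfold nsq
  calc ∑ i, (x i : ℝ) ^ 2 ≤ ∑ i : Fin d, (M : ℝ) ^ 2 := by
        refine Finset.sum_le_sum fun i _ => ?_
        have h1 : |(x i : ℝ)| ≤ M := by exact_mod_cast h i
        exact sq_le_sq' (abs_le.mp h1).1 (abs_le.mp h1).2
    _ = _ := by simp

/-- one-step comparison -/
lemma harnack_step {d : ℕ} (hd : 0 < d) : ∃ C : ℝ, 0 < C ∧ ∀ (R : ℕ), 1 ≤ R → ∀ H : Zd d → ℝ,
    (∀ x, 0 < H x) → (∀ x ∈ bx ((R : ℤ) + 1), H x = av H x) →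
    ∀ x, 2 * nsq x ≤ (R : ℝ) ^ 2 → ∀ j, H (x + u j) ≤ (1 + C / R) * H x := by
  obtain ⟨C, hC, hg⟩ := gradient hd
  refine ⟨2 * Real.sqrt C, by positivity, ?_⟩
  intro R hR H hH hharm x hx j
  have hR1 : (1 : ℝ) ≤ R := by exact_mod_cast hR
  have hn := nsq_nonneg x
  have h1 := hg R hR H hH hharm x (by nlinarith)
  have h2 : (rr H x j - 1) ^ 2 ≤ Phi H x :=
    Finset.single_le_sum (f := fun j => (rr H x j - 1) ^ 2) (fun j _ => sq_nonneg _)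
      (Finset.mem_univ j)
  have h3 : ((R : ℝ) ^ 2 / 2) ^ 2 * (rr H x j - 1) ^ 2 ≤ C * R ^ 2 := by
    refine le_trans ?_ h1
    gcongr
    linarith
  have h4 : (R * (rr H x j - 1)) ^ 2 ≤ (2 * Real.sqrt C) ^ 2 := by
    rw [mul_pow 2, Real.sq_sqrt hC.le]
    have hR2 : (0 : ℝ) < R ^ 2 := by positivity
    have : (R : ℝ) ^ 2 * ((R * (rr H x j - 1)) ^ 2) ≤ (R : ℝ) ^ 2 * (2 ^ 2 * C) := by nlinarith
    exact le_of_mul_le_mul_left this hR2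
  have h5 := (abs_le.mp (abs_le_of_sq_le_sq h4 (by positivity))).2
  have h6 : rr H x j ≤ 1 + 2 * Real.sqrt C / R := by
    have : rr H x j - 1 ≤ 2 * Real.sqrt C / R := by
      rw [le_div_iff₀ (by positivity)]; linarith
    linarith
  unfold rr at h6
  rwa [div_le_iff₀ (hH x)] at h6

lemma toward {d : ℕ} (v : Zd d) (hv : v ≠ 0) : ∃ (v' : Zd d) (j : Fin d × Bool),
    v = v' + u j ∧ (∑ i, (v' i).natAbs) + 1 = ∑ i, (v i).natAbs ∧ ∀ i, |v' i| ≤ |v i| := by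
  obtain ⟨i, hi⟩ : ∃ i, v i ≠ 0 := by
    by_contra! h; exact hv (funext h)
  have hi' : v i ≠ 0 := hi
  refine ⟨v - u (i, decide (0 < v i)), (i, decide (0 < v i)), by abel, ?_, ?_⟩
  · rw [← Finset.add_sum_erase _ _ (Finset.mem_univ i), ← Finset.add_sum_erase _ (fun i => (v i).natAbs) (Finset.mem_univ i)]
    have h1 : ∀ k ∈ Finset.univ.erase i, ((v - u (i, decide (0 < v i))) k).natAbs = (v k).natAbs := by
      intro k hk
      have : k ≠ i := Finset.ne_of_mem_erase hk
      simp [u, this]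
    rw [Finset.sum_congr rfl h1]
    have : ((v - u (i, decide (0 < v i))) i).natAbs + 1 = (v i).natAbs := by
      by_cases h : 0 < v i
      · simp [u, h]; omega
      · simp [u, h]; omega
    omega
  · intro k
    by_cases hk : k = i
    · subst hk
      by_cases h : 0 < v k
      · simp only [u, h, Pi.sub_apply, Pi.single_eq_same, decide_true, if_true]
        rw [abs_le]; constructor <;> [skip; skip] <;> rw [abs_of_pos h] <;> omega
      · have h' : v k < 0 := by omega
        simp only [u, h, Pi.sub_apply, Pi.single_eq_same, decide_false]
        rw [abs_le]; constructor <;> [skip; skip] <;> rw [abs_of_neg h'] <;> simp <;> omega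
    · simp [u, hk]

/-- Harnack inequality -/
lemma harnack {d : ℕ} (hd : 0 < d) : ∃ C : ℝ, 0 < C ∧ ∀ (R M : ℕ), 1 ≤ R →
    2 * (d : ℝ) * (M : ℝ) ^ 2 ≤ (R : ℝ) ^ 2 → ∀ H : Zd d → ℝ,
    (∀ x, 0 ≤ H x) → (∀ x ∈ bx ((R : ℤ) + 1), H x = av H x) →
    ∀ v ∈ bx (M : ℤ), H v ≤ Real.exp (C * M / R) * H 0 ∧ H 0 ≤ Real.exp (C * M / R) * H v := by
  obtain ⟨C, hC, hs⟩ := harnack_step hd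
  refine ⟨C * d, by positivity, ?_⟩
  intro R M hR hRM
  have hR1 : (1 : ℝ) ≤ R := by exact_mod_cast hR
  -- positive case
  have pos : ∀ H : Zd d → ℝ, (∀ x, 0 < H x) → (∀ x ∈ bx ((R : ℤ) + 1), H x = av H x) →
      ∀ n : ℕ, ∀ v ∈ bx (M : ℤ), (∑ i, (v i).natAbs) = n →
        H v ≤ (1 + C / R) ^ n * H 0 ∧ H 0 ≤ (1 + C / R) ^ n * H v := by
    intro H hH hharm n
    have hin : ∀ x : Zd d, x ∈ bx (M : ℤ) → 2 * nsq x ≤ (R : ℝ) ^ 2 := by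
      intro x hx
      have := nsq_le_of_bx hx
      push_cast at this
      linarith
    induction n with
    | zero =>
      intro v hv hn
      have : v = 0 := by
        funext i
        have := (Finset.sum_eq_zero_iff.mp hn) i (Finset.mem_univ i)
        simpa using this
      subst this; simp
    | succ n ih =>
      intro v hv hn
      have hv0 : v ≠ 0 := by rintro rfl; simp at hn
      obtain ⟨v', j, e, hsum, hle⟩ := toward v hv0
      have hv' : v' ∈ bx (M : ℤ) := fun i => (hle i).trans (hv i)
      obtain ⟨i1, i2⟩ := ih v' hv' (by omega)
      have s1 := hs R hR H hH hharm v' (hin v' hv') j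
      have s2 := hs R hR H hH hharm v (hin v hv) (opp j)
      rw [u_opp, e, add_neg_cancel_right, ← e] at s2
      rw [← e] at s1
      have hp : 0 ≤ 1 + C / R := by positivity
      constructor
      · calc H v ≤ _ := s1
          _ ≤ (1 + C / R) * ((1 + C / R) ^ n * H 0) := by gcongr
          _ = _ := by ring
      · calc H 0 ≤ _ := i2
          _ ≤ (1 + C / R) ^ n * ((1 + C / R) * H v) := by gcongr
          _ = _ := by ring
  have pos' : ∀ H : Zd d → ℝ, (∀ x, 0 < H x) → (∀ x ∈ bx ((R : ℤ) + 1), H x = av H x) →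
      ∀ v ∈ bx (M : ℤ), H v ≤ Real.exp (C * d * M / R) * H 0 ∧
        H 0 ≤ Real.exp (C * d * M / R) * H v := by
    intro H hH hharm v hv
    have hn : (∑ i, (v i).natAbs) ≤ d * M := by
      calc _ ≤ ∑ i : Fin d, M := Finset.sum_le_sum fun i _ => by
            have := abs_le.mp (hv i); omega
        _ = _ := by simp
    have hb : (1 + C / R) ^ (∑ i, (v i).natAbs) ≤ Real.exp (C * d * M / R) := by
      calc (1 + C / R) ^ (∑ i, (v i).natAbs) ≤ (1 + C / R) ^ (d * M) := by
            apply pow_le_pow_right₀ _ hn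
            have : 0 ≤ C / R := by positivity
            linarith
        _ ≤ (Real.exp (C / R)) ^ (d * M) := by
            gcongr; linarith [Real.add_one_le_exp (C / R)]
        _ = _ := by
            rw [← Real.exp_nat_mul]; congr 1; push_cast; ring
    obtain ⟨h1, h2⟩ := pos H hH hharm _ v hv rfl
    exact ⟨h1.trans (mul_le_mul_of_nonneg_right hb (hH 0).le),
      h2.trans (mul_le_mul_of_nonneg_right hb (hH v).le)⟩
  intro H hH hharm v hv
  set E := Real.exp (C * d * M / R)
  have hE : 0 < E := Real.exp_pos _
  have key : ∀ ε : ℝ, 0 < ε → H v + ε ≤ E * (H 0 + ε) ∧ H 0 + ε ≤ E * (H v + ε) := by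
    intro ε hε
    apply pos' (fun x => H x + ε) (fun x => by linarith [hH x]) _ v hv
    intro x hx
    rw [av_add, av_const hd, ← hharm x hx]
  constructor
  · apply _root_.le_of_forall_pos_le_add
    intro η hη
    have := (key (η / E) (by positivity)).1
    rw [mul_add, mul_div_cancel₀ _ hE.ne'] at this
    have h2 : 0 < η / E := by positivity
    linarith
  · apply _root_.le_of_forall_pos_le_add
    intro η hη
    have := (key (η / E) (by positivity)).2
    rw [mul_add, mul_div_cancel₀ _ hE.ne'] at this
    have h2 : 0 < η / E := by positivity
    linarith

end Pf

namespace Pf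

lemma box_sub_bx {d L : ℕ} {x : Zd d} (hx : x ∈ (intBox (-(4 * L : ℤ)) (5 * L) : Set (Zd d))) :
    x ∈ bx (5 * L : ℤ) := by
  intro i
  have := hx i
  rw [abs_le]; constructor <;> omega

/-- behaviour of a function vanishing on the small box on the intermediate shell -/
lemma shell {d : ℕ} (hd : 3 ≤ d) (D : Set (Zd d)) (R M : ℕ) (E p m : ℝ) (hE : 0 < E)
    (hMR : M ≤ R) (hm : 0 < m)
    (hDM : D ⊆ bx (M : ℤ)) (hDm : ∀ y ∈ D, m ≤ bar y)
    (hp : ∀ v : Zd d, (∃ i, |v i| = M) → bar v ≤ p * m)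
    (hharn : ∀ H : Zd d → ℝ, (∀ x, 0 ≤ H x) → (∀ x ∈ bx ((R : ℤ) + 1), H x = av H x) →
      ∀ v ∈ bx (M : ℤ), H v ≤ E * H 0 ∧ H 0 ≤ E * H v)
    (J : Zd d → ℝ) (hJ0 : ∀ x, 0 ≤ J x) (hJD : ∀ x ∈ D, J x = 0)
    (hJh : ∀ x ∈ bx ((R : ℤ) + 1), x ∉ D → J x = av J x) :
    ∃ a : ℝ, 0 ≤ a ∧ (∀ v ∈ bx (M : ℤ), J v ≤ E * a) ∧
      ∀ v ∈ bx (M : ℤ), (∃ i, |v i| = M) → (E⁻¹ - E * p) * a ≤ J v := by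
  have hd0 : 0 < d := by omega
  have hfin := bx_finite (d := d) ((R : ℤ) + 1)
  set U : Finset (Zd d) := hfin.toFinset with hU
  have hUm : ∀ x, x ∈ U ↔ x ∈ bx ((R : ℤ) + 1) := fun x => by simp [hU]
  obtain ⟨H, hHo, hHh⟩ := dirichlet hd0 U J
  have hJsub : ∀ x ∈ U, J x ≤ av J x := by
    intro x hx
    by_cases hxD : x ∈ D
    · rw [hJD x hxD]; exact av_nonneg hJ0 x
    · exact (hJh x ((hUm x).mp hx) hxD).le
  have hJH : ∀ x, J x ≤ H x := by
    intro x
    by_cases hx : x ∈ U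
    · have := max_principle hd0 U (fun x => J x - H x) (by
        intro x hx; rw [av_sub, ← hHh x hx]; linarith [hJsub x hx]) (by
        intro x _ j hj; rw [hHo _ hj]; simp) x hx
      simpa using this
    · rw [hHo x hx]
  have hH0 : ∀ x, 0 ≤ H x := fun x => (hJ0 x).trans (hJH x)
  have hHarn := hharn H hH0 (fun x hx => hHh x ((hUm x).mpr hx))
  have ha := hH0 0
  refine ⟨H 0, ha, fun v hv => (hJH v).trans (hHarn v hv).1, ?_⟩
  intro v hv hvM
  -- barrier comparison
  have hMR' : (bx (M : ℤ) : Set (Zd d)) ⊆ bx ((R : ℤ) + 1) := bx_mono (by omega)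
  have hbar : H v - J v ≤ E * H 0 / m * bar v := by
    by_cases hvD : v ∈ D
    · rw [hJD v hvD, sub_zero]
      have h1 := (hHarn v hv).1
      have h2 := hDm v hvD
      calc H v ≤ E * H 0 := h1
        _ = E * H 0 / m * m := by field_simp
        _ ≤ _ := by gcongr
    · have := max_principle hd0 (U.filter (· ∉ D))
        (fun x => (H x - J x) - E * H 0 / m * bar x) (by
          intro x hx
          rw [Finset.mem_filter] at hx
          rw [av_sub, av_sub, av_smul, ← hHh x hx.1, ← hJh x ((hUm x).mp hx.1) hx.2]
          have := mul_le_mul_of_nonneg_left (bar_super hd x)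
            (show 0 ≤ E * H 0 / m by positivity)
          linarith) (by
          intro x hx j hj
          rw [Finset.mem_filter] at hj
          by_cases hjD : x + u j ∈ D
          · rw [hJD _ hjD, sub_zero]
            have h1 := (hHarn _ (hDM hjD)).1
            have h2 := hDm _ hjD
            have : E * H 0 ≤ E * H 0 / m * bar (x + u j) := by
              calc E * H 0 = E * H 0 / m * m := by field_simp
                _ ≤ _ := by gcongr
            linarith
          · have : x + u j ∉ U := fun h => hj ⟨h, hjD⟩
            rw [hHo _ this]
            have h2 : 0 ≤ E * H 0 / m * bar (x + u j) :=
              mul_nonneg (by positivity) (bar_pos _).le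
            linarith) v (by
          rw [Finset.mem_filter]; exact ⟨(hUm v).mpr (hMR' hv), hvD⟩)
      linarith
  have h3 : E * H 0 / m * bar v ≤ E * H 0 / m * (p * m) := by
    gcongr; exact hp v hvM
  have h4 : E * H 0 / m * (p * m) = E * p * H 0 := by field_simp
  have h5 : E⁻¹ * H 0 ≤ H v := by
    rw [inv_mul_le_iff₀ hE]; exact (hHarn v hv).2
  rw [sub_mul]; linarith

set_option maxHeartbeats 4000000 in
lemma aml {d : ℕ} (hd : 3 ≤ d) (ε : ℝ) (hε : 0 < ε) (hε1 : ε ≤ 1) :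
    ∃ K0 : ℝ, ∀ L K : ℕ, 1 ≤ L → 100 ≤ K → K0 ≤ K → ∀ J1 J2 : Zd d → ℝ,
    (∀ x, 0 ≤ J1 x) → (∀ x, 0 ≤ J2 x) →
    (∀ x ∈ (intBox (-(4 * L : ℤ)) (5 * L) : Set (Zd d)), J1 x = 0) →
    (∀ x ∈ (intBox (-(4 * L : ℤ)) (5 * L) : Set (Zd d)), J2 x = 0) →
    (∀ x ∈ bx (((K : ℤ) - 1) * L), x ∉ (intBox (-(4 * L : ℤ)) (5 * L) : Set (Zd d)) →
      J1 x = av J1 x) →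
    (∀ x ∈ bx (((K : ℤ) - 1) * L), x ∉ (intBox (-(4 * L : ℤ)) (5 * L) : Set (Zd d)) →
      J2 x = av J2 x) →
    (∃ v ∈ bx (5 * L : ℤ), 0 < J1 v) → (∃ v ∈ bx (5 * L : ℤ), 0 < J2 v) →
    ∀ y ∈ (intBox (-(4 * L : ℤ)) (5 * L) : Set (Zd d)),
    ∀ y' ∈ (intBox (-(4 * L : ℤ)) (5 * L) : Set (Zd d)),
      av J1 y * av J2 y' ≤ (1 + ε) * (av J1 y' * av J2 y) := by
  have hd0 : 0 < d := by omega
  have hd3 : (3 : ℝ) ≤ d := by exact_mod_cast hd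
  obtain ⟨C, hC, hharn⟩ := harnack hd0
  set p : ℝ := ε / 8 with hp
  have hp0 : 0 < p := by positivity
  obtain ⟨r, hr⟩ := exists_nat_gt (max 7 ((25 * (d : ℝ) + 500) / p ^ 4))
  have hr7 : 7 < (r : ℝ) := (le_max_left _ _).trans_lt hr
  have hr7' : 7 < r := by exact_mod_cast hr7
  have hr2 : 25 * (d : ℝ) + 500 ≤ p ^ 4 * (r : ℝ) ^ 2 := by
    have h1 := (le_max_right _ _).trans hr.le
    rw [div_le_iff₀ (by positivity)] at h1
    have : (r : ℝ) ≤ r ^ 2 := by nlinarith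
    nlinarith [pow_pos hp0 4]
  refine ⟨max (8 * d * r) (32 * C * r / ε), ?_⟩
  intro L K hL hK100 hK J1 J2 hJ1 hJ2 hz1 hz2 hh1 hh2 hpos1 hpos2 y hy y' hy'
  have hKa : 8 * (d : ℝ) * r ≤ K := (le_max_left _ _).trans hK
  have hKb : 32 * C * r / ε ≤ K := (le_max_right _ _).trans hK
  have hL1 : (1 : ℝ) ≤ L := by exact_mod_cast hL
  have hK1 : (100 : ℝ) ≤ K := by exact_mod_cast hK100
  set R : ℕ := (K - 1) * L - 1 with hR
  have hRge : 1 ≤ (K - 1) * L := Nat.one_le_iff_ne_zero.mpr (by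
    apply Nat.mul_ne_zero <;> omega)
  have hR1 : (R : ℤ) + 1 = ((K : ℤ) - 1) * L := by
    have : ((R + 1 : ℕ) : ℤ) = (((K - 1) * L : ℕ) : ℤ) := by
      congr 1; omega
    push_cast [Nat.cast_sub (show 1 ≤ K by omega)] at this
    exact this
  have hRr : (R : ℝ) + 1 = ((K : ℝ) - 1) * L := by exact_mod_cast hR1
  have hRK : (K : ℝ) * L / 2 ≤ R := by nlinarith
  have hRpos : 1 ≤ R := by
    have : (1 : ℝ) ≤ R := by nlinarith
    exact_mod_cast this
  set M : ℕ := r * L with hM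
  have hMr : (M : ℝ) = r * L := by simp [hM]
  have hMR2 : 2 * (d : ℝ) * (M : ℝ) ^ 2 ≤ (R : ℝ) ^ 2 := by
    have h1 : 2 * (d : ℝ) * (r * L) ^ 2 ≤ ((K : ℝ) * L / 2) ^ 2 := by
      have h2 : (8 * (d : ℝ) * r) ^ 2 ≤ (K : ℝ) ^ 2 := by gcongr
      have h3 : 8 * (d : ℝ) * r ^ 2 ≤ K ^ 2 := by nlinarith [sq_nonneg (r : ℝ)]
      have h4 : 8 * (d : ℝ) * r ^ 2 * L ^ 2 ≤ K ^ 2 * L ^ 2 := by gcongr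
      nlinarith
    rw [hMr]
    exact h1.trans (by gcongr)
  have hMR : M ≤ R := by
    have : (M : ℝ) ≤ R := by
      apply le_of_sq_le_sq _ (by positivity)
      nlinarith [sq_nonneg (M : ℝ)]
    exact_mod_cast this
  set D : Set (Zd d) := intBox (-(4 * L : ℤ)) (5 * L) with hD
  set θ := C * M / R with hθ
  have hθε : θ ≤ ε / 16 := by
    rw [hθ, div_le_iff₀ (by positivity), hMr]
    rw [div_le_iff₀ hε] at hKb
    have : C * (r * L) ≤ ε / 16 * (K * L / 2) := by nlinarith
    exact this.trans (by gcongr)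
  have hθ0 : 0 ≤ θ := by positivity
  set E := Real.exp θ with hE
  have hE0 : 0 < E := Real.exp_pos _
  have hEinv : 1 - ε / 8 ≤ (E⁻¹) ^ 2 := by
    rw [hE, ← Real.exp_neg, ← Real.exp_nat_mul]
    have := Real.add_one_le_exp (((2 : ℕ) : ℝ) * -θ)
    push_cast at this ⊢
    linarith
  set m : ℝ := (25 * d * (L : ℝ) ^ 2 + 500) ^ (-(1 / 4) : ℝ) with hm
  have hbase : 0 < 25 * d * (L : ℝ) ^ 2 + 500 := by positivity
  have hm0 : 0 < m := Real.rpow_pos_of_pos hbase _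
  have h5M : (5 * L : ℤ) + 1 ≤ (M : ℤ) - 1 := by
    have : 7 * L ≤ r * L := Nat.mul_le_mul_right _ hr7'.le
    omega
  have hDM : D ⊆ bx (M : ℤ) := fun x hx => bx_mono (by omega) (box_sub_bx hx)
  have hDm : ∀ y ∈ D, m ≤ bar y := by
    intro y hy
    have := nsq_le_of_bx (box_sub_bx hy)
    push_cast at this
    exact Real.rpow_le_rpow_of_nonpos (by linarith [nsq_nonneg y]) (by nlinarith) (by norm_num)
  have hpM : ∀ v : Zd d, (∃ i, |v i| = M) → bar v ≤ p * m := by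
    rintro v ⟨i, hi⟩
    have h1 : ((M : ℝ)) ^ 2 ≤ nsq v := by
      have h2 : |(v i : ℝ)| = M := by exact_mod_cast hi
      rw [← h2, sq_abs]; exact sq_le_nsq v i
    have hn := nsq_nonneg v
    have h3 : 25 * d * (L : ℝ) ^ 2 + 500 ≤ p ^ 4 * (nsq v + 500) := by
      have hL2 : (1 : ℝ) ≤ L ^ 2 := by nlinarith
      calc 25 * d * (L : ℝ) ^ 2 + 500 ≤ (25 * d + 500) * L ^ 2 := by nlinarith
        _ ≤ p ^ 4 * r ^ 2 * L ^ 2 := by gcongr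
        _ = p ^ 4 * (M : ℝ) ^ 2 := by rw [hMr]; ring
        _ ≤ _ := by gcongr; linarith
    have h4 : (p ^ 4 * (nsq v + 500)) ^ (-(1 / 4) : ℝ) ≤ m :=
      Real.rpow_le_rpow_of_nonpos hbase h3 (by norm_num)
    rw [Real.mul_rpow (by positivity) (by linarith)] at h4
    have h5 : (p ^ 4) ^ (-(1 / 4) : ℝ) = p⁻¹ := by
      rw [← Real.rpow_natCast, ← Real.rpow_mul hp0.le]
      norm_num
      rw [Real.rpow_neg_one]
    rw [h5, inv_mul_le_iff₀ hp0] at h4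
    exact h4
  have hsh := shell hd D R M E p m hE0 hMR hm0 hDM hDm hpM
    (hharn R M hRpos hMR2)
  rw [← hR1] at hh1 hh2
  obtain ⟨a1, ha1, hu1, hl1⟩ := hsh J1 hJ1 hz1 hh1
  obtain ⟨a2, ha2, hu2, hl2⟩ := hsh J2 hJ2 hz2 hh2
  have h5sub : (bx (5 * L : ℤ) : Set (Zd d)) ⊆ bx (M : ℤ) := bx_mono (by omega)
  have ha1' : 0 < a1 := by
    obtain ⟨v, hv, hv'⟩ := hpos1
    have := hv'.trans_le (hu1 v (h5sub hv))
    exact pos_of_mul_pos_right this hE0.le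
  have ha2' : 0 < a2 := by
    obtain ⟨v, hv, hv'⟩ := hpos2
    have := hv'.trans_le (hu2 v (h5sub hv))
    exact pos_of_mul_pos_right this hE0.le
  set g := E⁻¹ - E * p with hg
  have hg_eq : g = E * ((E⁻¹) ^ 2 - p) := by rw [hg]; field_simp
  have hτ : 1 - ε / 4 ≤ (E⁻¹) ^ 2 - p := by rw [hp]; linarith
  have hg0 : 0 < g := by rw [hg_eq]; apply mul_pos hE0; linarith
  have hgE : E ^ 2 ≤ (1 + ε) * g ^ 2 := by
    rw [hg_eq, mul_pow]
    have h1 : (1 - ε / 4) ^ 2 ≤ ((E⁻¹) ^ 2 - p) ^ 2 := by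
      apply pow_le_pow_left₀ _ hτ; linarith
    have h2 : 1 ≤ (1 + ε) * (1 - ε / 4) ^ 2 := by
      have e1 : (1 + ε) * (1 - ε / 4) ^ 2 = 1 + ε * (1 - ε) / 2 + ε ^ 2 / 16 + ε ^ 3 / 16 := by ring
      have e2 : 0 ≤ ε * (1 - ε) := mul_nonneg hε.le (by linarith)
      rw [e1]
      have e3 : 0 ≤ ε ^ 2 := by positivity
      have e4 : 0 ≤ ε ^ 3 := by positivity
      linarith
    have h3 : 1 ≤ (1 + ε) * ((E⁻¹) ^ 2 - p) ^ 2 := h2.trans (by gcongr)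
    nlinarith [sq_nonneg E]
  -- comparison
  have comp : ∀ (Ja Jb : Zd d → ℝ) (a b : ℝ), 0 ≤ a → 0 ≤ b →
      (∀ x ∈ D, Ja x = 0) → (∀ x ∈ D, Jb x = 0) →
      (∀ x ∈ bx ((R : ℤ) + 1), x ∉ D → Ja x = av Ja x) →
      (∀ x ∈ bx ((R : ℤ) + 1), x ∉ D → Jb x = av Jb x) →
      (∀ v ∈ bx (M : ℤ), Ja v ≤ E * a) →
      (∀ v ∈ bx (M : ℤ), (∃ i, |v i| = M) → g * b ≤ Jb v) →
      ∀ y ∈ D, g * b * av Ja y ≤ E * a * av Jb y := by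
    intro Ja Jb a b ha hb hza hzb hha hhb hua hlb y hy
    have hfin := bx_finite (d := d) ((M : ℤ) - 1)
    have hle : ∀ x ∈ bx ((M : ℤ) - 1), g * b * Ja x - E * a * Jb x ≤ 0 := by
      intro x hx
      by_cases hxD : x ∈ D
      · rw [hza x hxD, hzb x hxD]; simp
      · refine max_principle hd0 (hfin.toFinset.filter (· ∉ D))
          (fun x => g * b * Ja x - E * a * Jb x) ?_ ?_ x (by simp [hx, hxD])
        · intro x hx
          simp only [Finset.mem_filter, Set.Finite.mem_toFinset] at hx
          have hxR : x ∈ bx ((R : ℤ) + 1) := bx_mono (by omega) hx.1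
          rw [av_sub, av_smul, av_smul, ← hha x hxR hx.2, ← hhb x hxR hx.2]
        · intro x hx j hj
          simp only [Finset.mem_filter, Set.Finite.mem_toFinset] at hx hj
          by_cases hjD : x + u j ∈ D
          · rw [hza _ hjD, hzb _ hjD]; simp
          · have hn : x + u j ∉ bx ((M : ℤ) - 1) := fun h => hj ⟨h, hjD⟩
            have hin : x + u j ∈ bx (M : ℤ) := by
              have := bx_add_u hx.1 j
              rwa [sub_add_cancel] at this
            have hex : ∃ i, |(x + u j) i| = M := by
              by_contra! hne
              apply hn
              intro i
              have h1 := hin i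
              have h2 := hne i
              omega
            have h1 := hua _ hin
            have h2 := hlb _ hin hex
            have h3 : g * b * Ja (x + u j) ≤ g * b * (E * a) := by gcongr
            have h4 : E * a * (g * b) ≤ E * a * Jb (x + u j) := by gcongr
            linarith
    have hav : av (fun x => g * b * Ja x - E * a * Jb x) y ≤ av (fun _ => 0) y := by
      apply av_mono
      intro j
      apply hle
      exact bx_mono (by omega) (bx_add_u (box_sub_bx hy) j)
    rw [av_const hd0, av_sub, av_smul, av_smul] at hav
    linarith
  have c1 := comp J1 J2 a1 a2 ha1 ha2 hz1 hz2 hh1 hh2 hu1 hl2 y hy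
  have c2 := comp J2 J1 a2 a1 ha2 ha1 hz2 hz1 hh2 hh1 hu2 hl1 y' hy'
  have n1 := av_nonneg hJ1 y
  have n1' := av_nonneg hJ1 y'
  have n2 := av_nonneg hJ2 y
  have n2' := av_nonneg hJ2 y'
  have hmul : (g * a2 * av J1 y) * (g * a1 * av J2 y') ≤ (E * a1 * av J2 y) * (E * a2 * av J1 y') :=
    mul_le_mul c1 c2 (by positivity) (by positivity)
  have hfin : (a1 * a2 * g ^ 2) * (av J1 y * av J2 y') ≤
      (a1 * a2 * g ^ 2) * ((1 + ε) * (av J1 y' * av J2 y)) := by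
    calc (a1 * a2 * g ^ 2) * (av J1 y * av J2 y')
        = (g * a2 * av J1 y) * (g * a1 * av J2 y') := by ring
      _ ≤ (E * a1 * av J2 y) * (E * a2 * av J1 y') := hmul
      _ = E ^ 2 * (a1 * a2 * (av J1 y' * av J2 y)) := by ring
      _ ≤ ((1 + ε) * g ^ 2) * (a1 * a2 * (av J1 y' * av J2 y)) := by gcongr
      _ = _ := by ring
  exact le_of_mul_le_mul_left hfin (by positivity)

end Pf

namespace Pf

lemma exp_univ : expMeasure Set.univ = 1 := by
  have := ProbabilityTheory.lintegral_exponentialPDF_eq_one (r := 1) one_pos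
  rw [expMeasure, withDensity_apply _ MeasurableSet.univ, Measure.restrict_univ, ← this]
  apply lintegral_congr_ae
  have : ∀ᵐ t : ℝ, t ≠ 0 := by simp [ae_iff]
  filter_upwards [this] with t ht
  rw [ProbabilityTheory.exponentialPDF_eq]
  congr 1
  by_cases h : 0 < t
  · simp [h, h.le]
  · have : ¬ 0 ≤ t := fun h' => h (lt_of_le_of_ne h' ht.symm)
    simp [h, this]

lemma exp_Iic : expMeasure (Set.Iic 0) = 0 := by
  rw [expMeasure, withDensity_apply _ measurableSet_Iic]
  rw [setLIntegral_congr_fun (g := fun _ => 0) measurableSet_Iic]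
  · simp
  · intro t ht
    simp only [Set.mem_Iic] at ht
    simp [not_lt.mpr ht]

lemma exp_Iio : expMeasure (Set.Iio 1) < 1 := by
  have h1 : expMeasure (Set.Iio 1) + expMeasure (Set.Ici 1) = 1 := by
    rw [← exp_univ, ← measure_union _ measurableSet_Ici]
    · congr 1; ext t; simp
    · rw [Set.disjoint_left]; intro t h1 h2; simp at h1 h2; linarith
  have h2 : expMeasure (Set.Ici 1) ≠ 0 := by
    rw [expMeasure, withDensity_apply _ measurableSet_Ici]
    intro h
    rw [lintegral_eq_zero_iff] at h
    · have h3 : ∀ᵐ t ∂(volume.restrict (Set.Ici (1:ℝ))), False := by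
        filter_upwards [h, ae_restrict_mem measurableSet_Ici] with t ht ht1
        simp only [Set.mem_Ici] at ht1
        have : (0:ℝ) < t := by linarith
        simp only [this, if_true, Pi.zero_apply, ENNReal.ofReal_eq_zero] at ht
        linarith [Real.exp_pos (-t)]
      rw [ae_iff] at h3
      simp at h3
    · apply Measurable.ennreal_ofReal
      apply Measurable.ite measurableSet_Ioi
      · fun_prop
      · fun_prop
  have h3 : expMeasure (Set.Iio 1) ≠ ⊤ := by
    intro h; rw [h] at h1; simp at h1
  rw [← h1]
  exact ENNReal.lt_add_right h3 h2

section
variable {d : ℕ} {Ω : Type*} [MeasurableSpace Ω] (W : SRW d Ω)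

lemma ae_Y0 (x : Zd d) : ∀ᵐ ω ∂(W.P x), W.Y 0 ω = x := by
  have := W.isProb x
  have hm : MeasurableSet {ω | W.Y 0 ω = x} := W.measurable_Y 0 (measurableSet_singleton x)
  rw [ae_iff]
  have := prob_compl_eq_zero_iff (μ := W.P x) hm
  exact this.mpr (W.Y_zero x)

lemma incr_law (x : Zd d) (n : ℕ) (s : Fin n → Zd d) :
    W.P x {ω | ∀ i : Fin n, W.Y ((i : ℕ) + 1) ω - W.Y (i : ℕ) ω = s i} = ∏ i, stepP d (s i) := by
  have := W.law x n s (fun _ => Set.univ) (fun _ => MeasurableSet.univ)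
  simpa [exp_univ] using this

lemma meas_incr (n : ℕ) (s : Fin n → Zd d) :
    MeasurableSet {ω | ∀ i : Fin n, W.Y ((i : ℕ) + 1) ω - W.Y (i : ℕ) ω = s i} := by
  rw [Set.ofPred_forall]
  refine MeasurableSet.iInter fun i => ?_
  exact ((W.measurable_Y _).sub (W.measurable_Y _)) (measurableSet_singleton (s i))

lemma sum_stepP {d : ℕ} {Ω : Type*} [MeasurableSpace Ω] (W : SRW d Ω) (x : Zd d) (n : ℕ) :
    ∑' s : Fin n → Zd d, ∏ i, stepP d (s i) = 1 := by
  have := W.isProb x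
  simp_rw [← incr_law W x n]
  rw [← measure_iUnion]
  · convert measure_univ (μ := W.P x)
    ext ω; simp only [Set.mem_iUnion, Set.mem_ofPred_eq, Set.mem_univ, iff_true]
    exact ⟨fun i => W.Y ((i : ℕ) + 1) ω - W.Y (i : ℕ) ω, fun i => rfl⟩
  · intro s t hst
    rw [Function.onFun, Set.disjoint_left]
    intro ω h1 h2
    exact hst (funext fun i => (h1 i).symm.trans (h2 i))
  · exact meas_incr W n

lemma zeta_law (x : Zd d) (n : ℕ) (I : Fin n → Set ℝ) (hI : ∀ i, MeasurableSet (I i)) :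
    W.P x {ω | ∀ i : Fin n, W.ζ (i : ℕ) ω ∈ I i} = ∏ i, expMeasure (I i) := by
  have h : {ω | ∀ i : Fin n, W.ζ (i : ℕ) ω ∈ I i} = ⋃ s : Fin n → Zd d,
      {ω | (∀ i : Fin n, W.Y ((i : ℕ) + 1) ω - W.Y (i : ℕ) ω = s i) ∧
             (∀ i : Fin n, W.ζ (i : ℕ) ω ∈ I i)} := by
    ext ω; simp only [Set.mem_iUnion, Set.mem_ofPred_eq]
    constructor
    · intro h; exact ⟨fun i => W.Y ((i : ℕ) + 1) ω - W.Y (i : ℕ) ω, fun i => rfl, h⟩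
    · rintro ⟨s, _, h⟩; exact h
  rw [h, measure_iUnion]
  · simp_rw [W.law x n _ I hI]
    rw [ENNReal.tsum_mul_right, sum_stepP W x n, one_mul]
  · intro s t hst
    rw [Function.onFun, Set.disjoint_left]
    intro ω h1 h2
    exact hst (funext fun i => (h1.1 i).symm.trans (h2.1 i))
  · intro s
    have h2 : MeasurableSet {ω | ∀ i : Fin n, W.ζ (i : ℕ) ω ∈ I i} := by
      rw [Set.ofPred_forall]
      exact MeasurableSet.iInter fun i => W.measurable_ζ _ (hI i)
    exact (meas_incr W n s).inter h2

lemma ae_zeta_pos (x : Zd d) : ∀ᵐ ω ∂(W.P x), ∀ n, 0 < W.ζ n ω := by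
  rw [ae_all_iff]
  intro n
  rw [ae_iff]
  have := zeta_law W x (n+1) (fun i => if i = Fin.last n then Set.Iic 0 else Set.univ)
    (by intro i; split_ifs; exacts [measurableSet_Iic, MeasurableSet.univ])
  have h0 : ∏ i : Fin (n+1), expMeasure (if i = Fin.last n then Set.Iic 0 else Set.univ) = 0 := by
    apply Finset.prod_eq_zero (Finset.mem_univ (Fin.last n))
    simp [exp_Iic]
  rw [h0] at this
  refine measure_mono_null ?_ this
  intro ω hω i
  simp only [Set.mem_ofPred_eq, not_lt] at hω
  by_cases h : i = Fin.last n
  · simp [h, hω]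
  · simp [h]

lemma ae_zeta_large (x : Zd d) : ∀ᵐ ω ∂(W.P x), ∀ N, ∃ i ≥ N, 1 ≤ W.ζ i ω := by
  rw [ae_all_iff]
  intro N
  rw [ae_iff]
  have hle : ∀ m : ℕ, W.P x {ω | ¬ ∃ i ≥ N, 1 ≤ W.ζ i ω} ≤ (expMeasure (Set.Iio 1)) ^ m := by
    intro m
    have := zeta_law W x (N+m) (fun i => if (i : ℕ) < N then Set.univ else Set.Iio 1)
      (by intro i; split_ifs; exacts [MeasurableSet.univ, measurableSet_Iio])
    have h0 : ∏ i : Fin (N+m), expMeasure (if (i : ℕ) < N then Set.univ else Set.Iio 1)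
        = (expMeasure (Set.Iio 1)) ^ m := by
      rw [Fin.prod_univ_add]
      simp [exp_univ]
    rw [h0] at this
    rw [← this]
    apply measure_mono
    intro ω hω i
    simp only [Set.mem_ofPred_eq] at hω
    push Not at hω
    by_cases h : (i : ℕ) < N
    · simp [h]
    · simp only [h, if_false, Set.mem_Iio]
      exact hω _ (not_lt.mp h)
  have ht := ENNReal.tendsto_pow_atTop_nhds_zero_of_lt_one exp_Iio
  exact le_antisymm (ge_of_tendsto' ht hle) bot_le

/-- good time configurations -/
def good (ω : Ω) : Prop := (∀ n, 0 < W.ζ n ω) ∧ ∀ N, ∃ i ≥ N, 1 ≤ W.ζ i ω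

lemma ae_good (x : Zd d) : ∀ᵐ ω ∂(W.P x), good W ω := by
  filter_upwards [ae_zeta_pos W x, ae_zeta_large W x] with ω h1 h2 using ⟨h1, h2⟩

variable {W}
lemma S_strict {ω : Ω} (h : good W ω) : StrictMono (fun n => W.S n ω) := by
  apply strictMono_nat_of_lt_succ
  intro n
  simp only [SRW.S, Finset.sum_range_succ]
  linarith [h.1 n]

lemma S_unbdd {ω : Ω} (h : good W ω) (m : ℕ) : ∃ n, (m : ℝ) ≤ W.S n ω := by
  induction m with
  | zero => exact ⟨0, by simp [SRW.S]⟩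
  | succ m ih =>
    obtain ⟨n, hn⟩ := ih
    obtain ⟨i, hi, h1⟩ := h.2 n
    refine ⟨i+1, ?_⟩
    have := (S_strict h).monotone hi
    simp only [SRW.S, Finset.sum_range_succ] at this hn ⊢
    push_cast; linarith

lemma jumpIdx_eq {ω : Ω} (h : good W ω) {t : ℝ} (ht : 0 ≤ t) :
    W.S (W.jumpIdx t ω) ω ≤ t ∧ ∀ k, W.S k ω ≤ t → k ≤ W.jumpIdx t ω := by
  obtain ⟨m, hm⟩ := exists_nat_gt t
  obtain ⟨n, hn⟩ := S_unbdd h m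
  have hb : BddAbove {k : ℕ | W.S k ω ≤ t} := by
    refine ⟨n, fun k hk => ?_⟩
    simp only [Set.mem_ofPred_eq] at hk
    by_contra hc
    have := S_strict h (not_le.mp hc)
    simp only at this
    linarith
  have hne : {k : ℕ | W.S k ω ≤ t}.Nonempty := ⟨0, by simp [SRW.S, ht]⟩
  exact ⟨Nat.sSup_mem hne hb, fun k hk => le_csSup hb hk⟩

lemma S_nonneg {ω : Ω} (h : good W ω) (n : ℕ) : 0 ≤ W.S n ω := by
  have := (S_strict h).monotone (Nat.zero_le n)
  simpa [SRW.S] using this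

lemma X_S {ω : Ω} (h : good W ω) (n : ℕ) : W.X (W.S n ω) ω = W.Y n ω := by
  have := jumpIdx_eq h (S_nonneg h n)
  have h1 := this.2 n le_rfl
  have h2 : W.jumpIdx (W.S n ω) ω ≤ n := (S_strict h).le_iff_le.mp this.1
  rw [SRW.X, le_antisymm h2 h1]

lemma X_zero {ω : Ω} (h : good W ω) : W.X 0 ω = W.Y 0 ω := by
  have := X_S h 0
  simpa [SRW.S] using this

lemma hit_top {ω : Ω} {A : Set (Zd d)} (hn : ∀ n, W.Y n ω ∉ A) : W.hit A ω = ⊤ := by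
  rw [SRW.hit, SRW.hitFrom]
  rw [sInf_eq_top]
  rintro _ ⟨s, -, -, hX⟩
  exact absurd hX (hn _)

lemma hit_eq {ω : Ω} (h : good W ω) {A : Set (Zd d)} {n : ℕ} (hn : W.Y n ω ∈ A)
    (hk : ∀ k < n, W.Y k ω ∉ A) : W.hit A ω = ENNReal.ofReal (W.S n ω) := by
  rw [SRW.hit, SRW.hitFrom]
  apply le_antisymm
  · apply sInf_le
    refine ⟨(W.S n ω).toNNReal, rfl, bot_le, ?_⟩
    rw [Real.coe_toNNReal _ (S_nonneg h n), X_S h]; exact hn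
  · apply le_sInf
    rintro _ ⟨s, rfl, -, hX⟩
    have h1 := jumpIdx_eq h s.2
    have h2 : n ≤ W.jumpIdx s ω := by
      by_contra hc
      exact hk _ (not_le.mp hc) hX
    rw [ENNReal.ofReal_le_coe]
    have := ((S_strict h).monotone h2).trans h1.1
    exact this

lemma hit_ne_top {ω : Ω} (h : good W ω) {A : Set (Zd d)} {n : ℕ} (hn : W.Y n ω ∈ A)
    (hk : ∀ k < n, W.Y k ω ∉ A) : W.hit A ω ≠ ⊤ ∧ W.Xat (W.hit A) ω = W.Y n ω := by
  rw [SRW.Xat, hit_eq h hn hk]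
  refine ⟨ENNReal.ofReal_ne_top, ?_⟩
  rw [ENNReal.toReal_ofReal (S_nonneg h n), X_S h]

lemma hitTilde_iff {ω : Ω} (h : good W ω) {A : Set (Zd d)} :
    W.hitTilde A ω = ⊤ ↔ ∀ n, W.Y (n+1) ω ∉ A := by
  have hS1 : W.ζ 0 ω = W.S 1 ω := by simp [SRW.S]
  constructor
  · intro ht n hn
    have : W.hitTilde A ω ≤ ENNReal.ofReal (W.S (n+1) ω) := by
      rw [SRW.hitTilde, SRW.hitFrom]
      apply sInf_le
      refine ⟨(W.S (n+1) ω).toNNReal, rfl, ?_, ?_⟩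
      · rw [hS1]
        exact ENNReal.ofReal_le_ofReal ((S_strict h).monotone (by omega))
      · rw [Real.coe_toNNReal _ (S_nonneg h _), X_S h]; exact hn
    rw [ht] at this
    exact ENNReal.ofReal_ne_top (top_le_iff.mp this)
  · intro hn
    rw [SRW.hitTilde, SRW.hitFrom]
    rw [sInf_eq_top]
    rintro _ ⟨s, rfl, hs, hX⟩
    exfalso
    rw [ENNReal.ofReal_le_coe, hS1] at hs
    have h2 := (jumpIdx_eq h s.2).2 1 hs
    obtain ⟨m, hm⟩ := Nat.exists_eq_add_of_le' h2
    rw [SRW.X] at hX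
    have hX' : W.Y (W.jumpIdx s ω) ω ∈ A := hX
    have hm' : W.jumpIdx s ω = m + 1 := hm
    rw [hm'] at hX'
    exact hn _ hX'

end
end Pf

namespace Pf

lemma u_inj {d : ℕ} : Function.Injective (u (d := d)) := by
  rintro ⟨i, a⟩ ⟨j, b⟩ h
  have h1 := congrFun h i
  have h2 := congrFun h j
  simp only [u, Pi.single_eq_same] at h1 h2
  by_cases hij : i = j
  · subst hij
    simp only [Pi.single_eq_same] at h1
    cases a <;> cases b <;> simp_all
  · rw [Pi.single_eq_of_ne hij] at h1
    cases a <;> simp at h1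

lemma norm_u {d : ℕ} (j : Fin d × Bool) : ∑ i, ((u j : Zd d) i).natAbs = 1 := by
  rw [Finset.sum_eq_single j.1]
  · simp only [u, Pi.single_eq_same]; split_ifs <;> rfl
  · intro b _ hb; simp [u, Pi.single_eq_of_ne hb]
  · simp

lemma ex_u {d : ℕ} (v : Zd d) (hv : ∑ i, (v i).natAbs = 1) : ∃ j, v = u j := by
  obtain ⟨i, hi⟩ : ∃ i, (v i).natAbs ≠ 0 := by
    by_contra hc
    push Not at hc
    simp [hc] at hv
  have hs := Finset.add_sum_erase Finset.univ (fun i => (v i).natAbs) (Finset.mem_univ i)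
  rw [hv] at hs
  have h1 : (v i).natAbs = 1 := by omega
  have h2 : ∑ k ∈ Finset.univ.erase i, (v k).natAbs = 0 := by omega
  have h3 : ∀ k, k ≠ i → v k = 0 := fun k hk => by
    have := (Finset.sum_eq_zero_iff.mp h2) k (by simp [hk])
    simpa using this
  rcases Int.natAbs_eq (v i) with h | h
  · refine ⟨(i, true), ?_⟩
    funext k
    by_cases hk : k = i
    · subst hk; simp [u]; rw [h, h1]; rfl
    · simp [u, Pi.single_eq_of_ne hk, h3 k hk]
  · refine ⟨(i, false), ?_⟩
    funext k
    by_cases hk : k = i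
    · subst hk; simp [u]; rw [h, h1]; rfl
    · simp [u, Pi.single_eq_of_ne hk, h3 k hk]

lemma stepP_eq {d : ℕ} (v : Zd d) :
    stepP d v = ∑ j : Fin d × Bool, if v = u j then ((2 * d : ℕ) : ℝ≥0∞)⁻¹ else 0 := by
  unfold stepP
  split_ifs with h
  · obtain ⟨j, rfl⟩ := ex_u v h
    rw [Finset.sum_eq_single j]
    · simp
    · intro b _ hb; rw [if_neg]; exact fun h => hb (u_inj h.symm)
    · simp
  · symm
    apply Finset.sum_eq_zero
    intro j _
    rw [if_neg]; rintro rfl; exact h (norm_u j)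

section
variable {d : ℕ} {Ω : Type*} [MeasurableSpace Ω] (W : SRW d Ω)

lemma path0 (x : Zd d) (n : ℕ) (p : Fin (n+1) → Zd d) :
    W.P x {ω | ∀ i : Fin (n+1), W.Y i ω = p i}
      = if p 0 = x then ∏ i : Fin n, stepP d (p i.succ - p i.castSucc) else 0 := by
  split_ifs with h
  · rw [← incr_law W x]
    apply measure_congr
    filter_upwards [ae_Y0 W x] with ω hω
    apply propext
    change (∀ i : Fin (n+1), W.Y i ω = p i) ↔
      ∀ i : Fin n, W.Y ((i : ℕ) + 1) ω - W.Y (i : ℕ) ω = p i.succ - p i.castSucc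
    constructor
    · intro hp i
      have h1 := hp i.succ
      have h2 := hp i.castSucc
      simp only [Fin.val_succ, Fin.val_castSucc] at h1 h2
      rw [h1, h2]
    · intro hp i
      induction i using Fin.induction with
      | zero => simp [hω, h]
      | succ i ih =>
        have := hp i
        simp only [Fin.val_succ, Fin.val_castSucc] at ih ⊢
        rw [ih] at this
        exact sub_left_inj.mp this
  · have : ∀ᵐ ω ∂(W.P x), ¬ ∀ i : Fin (n+1), W.Y i ω = p i := by
      filter_upwards [ae_Y0 W x] with ω hω hp
      have := hp 0
      simp only [Fin.val_zero] at this
      exact h (this.symm.trans hω)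
    rw [ae_iff] at this
    simpa using this

lemma path1 (x : Zd d) (n : ℕ) (p : Fin (n+1) → Zd d) :
    W.P x {ω | ∀ i : Fin (n+1), W.Y ((i : ℕ)+1) ω = p i}
      = stepP d (p 0 - x) * ∏ i : Fin n, stepP d (p i.succ - p i.castSucc) := by
  have := incr_law W x (n+1) (Fin.cons (p 0 - x) (fun i : Fin n => p i.succ - p i.castSucc))
  rw [Fin.prod_univ_succ] at this
  simp only [Fin.cons_zero, Fin.cons_succ] at this
  rw [← this]
  apply measure_congr
  filter_upwards [ae_Y0 W x] with ω hω
  apply propext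
  change (∀ i : Fin (n+1), W.Y ((i : ℕ)+1) ω = p i) ↔
    ∀ i : Fin (n+1), W.Y ((i : ℕ) + 1) ω - W.Y (i : ℕ) ω =
      (Fin.cons (p 0 - x) (fun i : Fin n => p i.succ - p i.castSucc) : Fin (n+1) → Zd d) i
  constructor
  · intro hp i
    refine Fin.cases ?_ (fun i => ?_) i
    · have := hp 0
      simp only [Fin.val_zero, zero_add] at this
      simp [this, hω]
    · have h1 := hp i.succ
      have h2 := hp i.castSucc
      simp only [Fin.val_succ, Fin.val_castSucc, Fin.cons_succ] at h1 h2 ⊢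
      rw [h1, h2]
  · intro hp i
    induction i using Fin.induction with
    | zero =>
      have := hp 0
      simp only [Fin.val_zero, Fin.cons_zero, hω] at this ⊢
      exact sub_left_inj.mp this
    | succ i ih =>
      have := hp i.succ
      simp only [Fin.val_succ, Fin.val_castSucc, Fin.cons_succ] at ih this ⊢
      rw [ih] at this
      exact sub_left_inj.mp this

lemma step_measure (x : Zd d) (n : ℕ) :
    (W.P x).map (fun ω (i : Fin (n+1)) => W.Y ((i : ℕ)+1) ω)
      = ∑ j : Fin d × Bool, ((2 * d : ℕ) : ℝ≥0∞)⁻¹ •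
        (W.P (x + u j)).map (fun ω (i : Fin (n+1)) => W.Y (i : ℕ) ω) := by
  have m1 : Measurable (fun ω (i : Fin (n+1)) => W.Y ((i : ℕ)+1) ω) :=
    measurable_pi_lambda _ fun i => W.measurable_Y _
  have m0 : Measurable (fun ω (i : Fin (n+1)) => W.Y (i : ℕ) ω) :=
    measurable_pi_lambda _ fun i => W.measurable_Y _
  apply Measure.ext_of_singleton
  intro p
  rw [Measure.map_apply m1 (measurableSet_singleton p)]
  have e1 : (fun ω (i : Fin (n+1)) => W.Y ((i : ℕ)+1) ω) ⁻¹' {p}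
      = {ω | ∀ i : Fin (n+1), W.Y ((i : ℕ)+1) ω = p i} := by
    ext ω; simp [funext_iff]
  have e0 : (fun ω (i : Fin (n+1)) => W.Y ((i : ℕ)) ω) ⁻¹' {p}
      = {ω | ∀ i : Fin (n+1), W.Y ((i : ℕ)) ω = p i} := by
    ext ω; simp [funext_iff]
  rw [e1, path1, Measure.finsetSum_apply, stepP_eq, Finset.sum_mul]
  apply Finset.sum_congr rfl
  intro j _
  rw [Measure.smul_apply, Measure.map_apply m0 (measurableSet_singleton p), e0, path0]
  by_cases h : p 0 = x + u j
  · rw [if_pos h, if_pos (by rw [h]; simp)]; rfl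
  · rw [if_neg h, if_neg (fun h' => h (by rw [← h']; simp))]; simp

/-- real-valued probabilities of path events -/
noncomputable def pr (x : Zd d) (Q : (ℕ → Zd d) → Prop) : ℝ :=
  (W.P x {ω | Q (fun k => W.Y k ω)}).toReal

/-- dependence on the first coordinates only -/
def dep (n : ℕ) (Q : (ℕ → Zd d) → Prop) : Prop :=
  ∀ p q : ℕ → Zd d, (∀ k ≤ n, p k = q k) → Q p → Q q

lemma dep_eq {n : ℕ} {Q : (ℕ → Zd d) → Prop} (h : dep n Q) (p : ℕ → Zd d) :
    Q p ↔ (fun i : Fin (n+1) => p i) ∈ {q : Fin (n+1) → Zd d | Q (fun k => q ⟨min k n, by omega⟩)} := by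
  change Q p ↔ Q (fun k => p (min k n))
  constructor
  · apply h; intro k hk; simp [hk]
  · apply h; intro k hk; simp [hk]

lemma dep_meas {n : ℕ} {Q : (ℕ → Zd d) → Prop} (h : dep n Q) :
    MeasurableSet {ω | Q (fun k => W.Y k ω)} := by
  have m0 : Measurable (fun ω (i : Fin (n+1)) => W.Y (i : ℕ) ω) :=
    measurable_pi_lambda _ fun i => W.measurable_Y _
  have : {ω | Q (fun k => W.Y k ω)} = (fun ω (i : Fin (n+1)) => W.Y (i : ℕ) ω) ⁻¹'
      {q : Fin (n+1) → Zd d | Q (fun k => q ⟨min k n, by omega⟩)} := by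
    ext ω; exact dep_eq h _
  rw [this]
  exact m0 (Set.to_countable _).measurableSet

lemma step1 {n : ℕ} {Q : (ℕ → Zd d) → Prop} (h : dep n Q) (x : Zd d) :
    pr W x (fun p => Q (fun k => p (k+1))) = av (fun v => pr W v Q) x := by
  have m0 : Measurable (fun ω (i : Fin (n+1)) => W.Y (i : ℕ) ω) :=
    measurable_pi_lambda _ fun i => W.measurable_Y _
  have m1 : Measurable (fun ω (i : Fin (n+1)) => W.Y ((i : ℕ)+1) ω) :=
    measurable_pi_lambda _ fun i => W.measurable_Y _
  have e0 : {ω | Q (fun k => W.Y k ω)} = (fun ω (i : Fin (n+1)) => W.Y (i : ℕ) ω) ⁻¹'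
      {q : Fin (n+1) → Zd d | Q (fun k => q ⟨min k n, by omega⟩)} := by
    ext ω; exact dep_eq h _
  have e1 : {ω | Q (fun k => W.Y (k+1) ω)} = (fun ω (i : Fin (n+1)) => W.Y ((i : ℕ)+1) ω) ⁻¹'
      {q : Fin (n+1) → Zd d | Q (fun k => q ⟨min k n, by omega⟩)} := by
    ext ω; exact dep_eq h (fun k => W.Y (k+1) ω)
  have hm : MeasurableSet {q : Fin (n+1) → Zd d | Q (fun k => q ⟨min k n, by omega⟩)} :=
    (Set.to_countable _).measurableSet
  have key := congrArg (fun μ => (μ {q : Fin (n+1) → Zd d | Q (fun k => q ⟨min k n, by omega⟩)}).toReal)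
    (step_measure W x n)
  simp only [Measure.finsetSum_apply, Measure.smul_apply] at key
  rw [Measure.map_apply m1 hm, ← e1] at key
  simp_rw [Measure.map_apply m0 hm, ← e0] at key
  unfold pr av
  rw [key, ENNReal.toReal_sum, Finset.mul_sum]
  · apply Finset.sum_congr rfl
    intro j _
    simp
  · intro j _
    have := W.isProb (x + u j)
    by_cases hd : d = 0
    · subst hd; exact j.1.elim0
    · simp only [smul_eq_mul]
      refine ENNReal.mul_ne_top ?_ (measure_ne_top _ _)
      simp [hd]

end
end Pf

namespace Pf

section det
variable {d : ℕ}

lemma av_comm (f : Zd d → Zd d → ℝ) (x v : Zd d) :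
    av (fun w => av (f w) v) x = av (fun w' => av (fun w => f w w') x) v := by
  simp only [av, ← Finset.mul_sum]
  rw [Finset.sum_comm]

lemma av_tendsto {f : ℕ → Zd d → ℝ} {g : Zd d → ℝ}
    (h : ∀ v, Filter.Tendsto (fun n => f n v) Filter.atTop (nhds (g v))) (x : Zd d) :
    Filter.Tendsto (fun n => av (f n) x) Filter.atTop (nhds (av g x)) := by
  unfold av
  exact (tendsto_finsetSum _ fun j _ => h _).const_mul _

lemma av_ind_symm (x y : Zd d) :
    av (fun w => if w = y then (1:ℝ) else 0) x = av (fun w => if x = w then (1:ℝ) else 0) y := by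
  unfold av
  congr 1
  rw [← sum_opp]
  apply Finset.sum_congr rfl
  intro j _
  have : (x + u (opp j) = y) ↔ (x = y + u j) := by
    rw [u_opp, ← sub_eq_add_neg, sub_eq_iff_eq_add]
  simp [this]

/-- killed transition probabilities -/
noncomputable def bb (C : Set (Zd d)) : ℕ → Zd d → Zd d → ℝ
  | 0, x, v => if x = v ∧ x ∉ C then 1 else 0
  | n+1, x, v => if x ∈ C then 0 else av (fun w => bb C n w v) x

/-- first hitting probabilities -/
noncomputable def hh (C : Set (Zd d)) : ℕ → Zd d → Zd d → ℝ
  | 0, x, v => if x = v then 1 else 0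
  | n+1, x, v => if x ∈ C then 0 else av (fun w => hh C n w v) x

lemma bb_nonneg (C : Set (Zd d)) (n : ℕ) (x v : Zd d) : 0 ≤ bb C n x v := by
  induction n generalizing x with
  | zero => simp only [bb]; split_ifs <;> norm_num
  | succ n ih =>
    simp only [bb]; split_ifs
    · exact le_rfl
    · exact av_nonneg (fun w => ih w) x

lemma av_zero (x : Zd d) : av (fun _ => (0:ℝ)) x = 0 := by simp [av]

lemma bb_start (C : Set (Zd d)) (n : ℕ) (x v : Zd d) (hx : x ∈ C) : bb C n x v = 0 := by
  cases n <;> simp [bb, hx]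

lemma bb_end (C : Set (Zd d)) (n : ℕ) (x v : Zd d) (hv : v ∈ C) : bb C n x v = 0 := by
  induction n generalizing x with
  | zero => simp only [bb]; rw [if_neg]; rintro ⟨rfl, h⟩; exact h hv
  | succ n ih => simp only [bb, ih, av_zero, ite_self]

lemma bb_last (C : Set (Zd d)) (n : ℕ) (x v : Zd d) :
    bb C (n+1) x v = if v ∈ C then 0 else av (fun w => bb C n x w) v := by
  induction n generalizing x with
  | zero =>
    by_cases hv : v ∈ C
    · rw [if_pos hv, bb_end _ _ _ _ hv]
    · rw [if_neg hv]
      by_cases hx : x ∈ C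
      · simp only [bb_start C _ x _ hx, av_zero]
      · simp only [bb, hx, if_false, not_false_eq_true, and_true]
        rw [← av_ind_symm]
        apply av_congr
        intro j
        by_cases h : x + u j = v
        · simp [h, hv]
        · simp [h]
  | succ n ih =>
    by_cases hv : v ∈ C
    · rw [if_pos hv, bb_end _ _ _ _ hv]
    · rw [if_neg hv]
      by_cases hx : x ∈ C
      · simp only [bb_start C _ x _ hx, av_zero]
      · rw [bb, if_neg hx]
        simp only [ih, if_neg hv]
        rw [av_comm]
        apply av_congr
        intro j
        rw [bb, if_neg hx]

lemma hh_bb (C : Set (Zd d)) (n : ℕ) (x y : Zd d) (hy : y ∈ C) :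
    hh C (n+1) x y = av (fun w => bb C n x w) y := by
  induction n generalizing x with
  | zero =>
    by_cases hx : x ∈ C
    · simp only [bb_start C _ x _ hx, av_zero, hh, hx, if_true]
    · simp only [bb, hh, hx, if_false, not_false_eq_true, and_true]
      rw [av_ind_symm]
  | succ n ih =>
    by_cases hx : x ∈ C
    · rw [hh]; simp only [bb_start C _ x _ hx, av_zero, hx, if_true]
    · rw [hh, if_neg hx]
      simp only [ih]
      rw [av_comm]
      apply av_congr
      intro j
      rw [bb, if_neg hx]

lemma av_finsum (N : ℕ) (f : ℕ → Zd d → ℝ) (x : Zd d) :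
    ∑ n ∈ Finset.range N, av (f n) x = av (fun w => ∑ n ∈ Finset.range N, f n w) x := by
  simp only [av, ← Finset.mul_sum]
  rw [Finset.sum_comm]

lemma bb_green (hd : 3 ≤ d) (C : Set (Zd d)) (N : ℕ) (x v : Zd d) :
    (bar (0 : Zd d) - av bar (0 : Zd d)) * ∑ n ∈ Finset.range N, bb C n x v ≤ bar (x - v) := by
  have hc := bar_strict hd
  induction N generalizing x with
  | zero => simp [(bar_pos _).le]
  | succ N ih =>
    by_cases hx : x ∈ C
    · simp only [bb_start C _ x _ hx, Finset.sum_const_zero, mul_zero]; exact (bar_pos _).le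
    · rw [Finset.sum_range_succ']
      have e : ∑ n ∈ Finset.range N, bb C (n+1) x v
          = av (fun w => ∑ n ∈ Finset.range N, bb C n w v) x := by
        rw [← av_finsum]
        apply Finset.sum_congr rfl; intro n _
        rw [bb, if_neg hx]
      rw [e, mul_add, ← av_smul]
      have h1 : av (fun w => (bar (0 : Zd d) - av bar (0 : Zd d)) * ∑ n ∈ Finset.range N, bb C n w v) x
          ≤ av bar (x - v) := by
        rw [← av_shift]
        exact av_mono _ fun j => ih _
      by_cases hxv : x = v
      · subst hxv
        simp only [sub_self] at h1 ⊢
        have : bb C 0 x x = 1 := by simp [bb, hx]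
        rw [this]; linarith
      · have : bb C 0 x v = 0 := by simp [bb, hxv]
        rw [this]
        have := bar_super hd (x - v)
        linarith

lemma bb_summable (hd : 3 ≤ d) (C : Set (Zd d)) (x v : Zd d) : Summable (fun n => bb C n x v) := by
  have hc := bar_strict hd
  have hc' : 0 < bar (0 : Zd d) - av bar (0 : Zd d) := by linarith
  apply summable_of_sum_range_le (c := bar (x - v) / (bar (0 : Zd d) - av bar (0 : Zd d)))
  · intro n; exact bb_nonneg C n x v
  · intro N
    rw [le_div_iff₀ hc', mul_comm]
    exact bb_green hd C N x v

noncomputable def gg (C : Set (Zd d)) (x v : Zd d) : ℝ := ∑' n, bb C n x v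

lemma gg_nonneg (C : Set (Zd d)) (x v : Zd d) : 0 ≤ gg C x v := tsum_nonneg fun n => bb_nonneg C n x v

lemma gg_end (C : Set (Zd d)) (x v : Zd d) (hv : v ∈ C) : gg C x v = 0 := by
  simp [gg, bb_end C _ x v hv]

lemma av_tsum (hd : 3 ≤ d) (C : Set (Zd d)) (x v : Zd d) :
    ∑' n, av (fun w => bb C n x w) v = av (gg C x) v ∧
    Summable (fun n => av (fun w => bb C n x w) v) := by
  have hs : Summable (fun n => av (fun w => bb C n x w) v) := by
    unfold av
    apply Summable.mul_left
    exact summable_sum fun j _ => bb_summable hd C x _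
  refine ⟨?_, hs⟩
  unfold av gg
  rw [tsum_mul_left, Summable.tsum_finsetSum]
  intro j _; exact bb_summable hd C x _

lemma gg_harm (hd : 3 ≤ d) (C : Set (Zd d)) (x v : Zd d) (hv : v ∉ C) (hxv : v ≠ x) :
    gg C x v = av (gg C x) v := by
  rw [← (av_tsum hd C x v).1, gg, (bb_summable hd C x v).tsum_eq_zero_add]
  have : bb C 0 x v = 0 := by simp [bb, hxv.symm]
  rw [this, zero_add]
  congr 1; funext n
  rw [bb_last, if_neg hv]

end det

section
variable {d : ℕ} {Ω : Type*} [MeasurableSpace Ω] (W : SRW d Ω)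

lemma pr_nonneg (x : Zd d) (Q) : 0 ≤ pr W x Q := ENNReal.toReal_nonneg

lemma pr_le_one (x : Zd d) (Q) : pr W x Q ≤ 1 := by
  have := W.isProb x
  exact ENNReal.toReal_le_of_le_ofReal zero_le_one (by simpa using prob_le_one)

lemma pr_congr (x : Zd d) {Q Q' : (ℕ → Zd d) → Prop} (h : ∀ p, p 0 = x → (Q p ↔ Q' p)) :
    pr W x Q = pr W x Q' := by
  unfold pr
  congr 1
  apply measure_congr
  filter_upwards [ae_Y0 W x] with ω hω
  exact propext (h _ hω)

lemma pr_false (x : Zd d) : pr W x (fun _ => False) = 0 := by simp [pr]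
lemma pr_true (x : Zd d) : pr W x (fun _ => True) = 1 := by
  have := W.isProb x
  simp [pr]

lemma pr_bb (C : Set (Zd d)) (n : ℕ) (x v : Zd d) :
    pr W x (fun p => p n = v ∧ ∀ k ≤ n, p k ∉ C) = bb C n x v := by
  induction n generalizing x with
  | zero =>
    rw [bb]
    split_ifs with h
    · rw [← pr_true W x]; apply pr_congr; intro p hp
      simp [hp, h.1, h.1 ▸ h.2]
    · rw [← pr_false W x]; apply pr_congr; intro p hp
      simpa [hp] using h
  | succ n ih =>
    rw [bb]
    split_ifs with h
    · rw [← pr_false W x]; apply pr_congr; intro p hp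
      simp only [iff_false]
      rintro ⟨-, h2⟩
      exact h2 0 (by omega) (hp ▸ h)
    · simp_rw [← ih]
      rw [← step1 W (n := n)]
      · apply pr_congr; intro p hp
        constructor
        · rintro ⟨h1, h2⟩; exact ⟨h1, fun k hk => h2 _ (by omega)⟩
        · rintro ⟨h1, h2⟩; refine ⟨h1, fun k hk => ?_⟩
          cases k with
          | zero => rwa [hp]
          | succ k => exact h2 k (by omega)
      · rintro p q hpq ⟨h1, h2⟩
        exact ⟨(hpq n le_rfl) ▸ h1, fun k hk => (hpq k hk) ▸ h2 k hk⟩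

lemma pr_hh (C : Set (Zd d)) (n : ℕ) (x v : Zd d) :
    pr W x (fun p => p n = v ∧ ∀ k < n, p k ∉ C) = hh C n x v := by
  induction n generalizing x with
  | zero =>
    rw [hh]
    split_ifs with h
    · rw [← pr_true W x]; apply pr_congr; intro p hp
      simp [hp, h]
    · rw [← pr_false W x]; apply pr_congr; intro p hp
      simpa [hp] using h
  | succ n ih =>
    rw [hh]
    split_ifs with h
    · rw [← pr_false W x]; apply pr_congr; intro p hp
      simp only [iff_false]
      rintro ⟨-, h2⟩
      exact h2 0 (by omega) (hp ▸ h)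
    · simp_rw [← ih]
      rw [← step1 W (n := n)]
      · apply pr_congr; intro p hp
        constructor
        · rintro ⟨h1, h2⟩; exact ⟨h1, fun k hk => h2 _ (by omega)⟩
        · rintro ⟨h1, h2⟩; refine ⟨h1, fun k hk => ?_⟩
          cases k with
          | zero => rwa [hp]
          | succ k => exact h2 k (by omega)
      · rintro p q hpq ⟨h1, h2⟩
        exact ⟨(hpq n le_rfl) ▸ h1, fun k hk => (hpq k hk.le) ▸ h2 k hk⟩

/-- escape probability -/
noncomputable def esc (A : Set (Zd d)) (v : Zd d) : ℝ := pr W v (fun p => ∀ n, p n ∉ A)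

lemma dep_avoid (A : Set (Zd d)) (n : ℕ) : dep n (fun p : ℕ → Zd d => ∀ k ≤ n, p k ∉ A) :=
  fun _ _ hpq h k hk => (hpq k hk) ▸ h k hk

lemma esc_lim (A : Set (Zd d)) (v : Zd d) :
    Filter.Tendsto (fun n => pr W v (fun p => ∀ k ≤ n, p k ∉ A)) Filter.atTop (nhds (esc W A v)) := by
  have := W.isProb v
  unfold esc pr
  have e : {ω | ∀ n, W.Y n ω ∉ A} = ⋂ n, {ω | ∀ k ≤ n, W.Y k ω ∉ A} := by
    ext ω; simp only [Set.mem_ofPred_eq, Set.mem_iInter]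
    exact ⟨fun h n k _ => h k, fun h n => h n n le_rfl⟩
  rw [e]
  apply (ENNReal.tendsto_toReal (measure_ne_top _ _)).comp
  apply tendsto_measure_iInter_atTop
  · intro n; exact (dep_meas W (dep_avoid A n)).nullMeasurableSet
  · intro m n hmn ω h k hk; exact h k (hk.trans hmn)
  · exact ⟨0, measure_ne_top _ _⟩

lemma avoid_in (A : Set (Zd d)) (v : Zd d) (hv : v ∈ A) (n : ℕ) :
    pr W v (fun p => ∀ k ≤ n, p k ∉ A) = 0 := by
  rw [← pr_false W v]; apply pr_congr; intro p hp
  simp only [iff_false]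
  exact fun h => h 0 (by omega) (hp ▸ hv)

lemma avoid_shift (A : Set (Zd d)) (v : Zd d) (n : ℕ) :
    pr W v (fun p => ∀ k ≤ n, p (k+1) ∉ A) = av (fun w => pr W w (fun p => ∀ k ≤ n, p k ∉ A)) v :=
  step1 W (dep_avoid A n) v

lemma avoid_out (A : Set (Zd d)) (v : Zd d) (hv : v ∉ A) (n : ℕ) :
    pr W v (fun p => ∀ k ≤ n+1, p k ∉ A) = av (fun w => pr W w (fun p => ∀ k ≤ n, p k ∉ A)) v := by
  rw [← avoid_shift]
  apply pr_congr; intro p hp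
  constructor
  · intro h2 k hk; exact h2 _ (by omega)
  · intro h2 k hk
    cases k with
    | zero => rwa [hp]
    | succ k => exact h2 k (by omega)

lemma esc_in (A : Set (Zd d)) (v : Zd d) (hv : v ∈ A) : esc W A v = 0 := by
  rw [esc, ← pr_false W v]; apply pr_congr; intro p hp
  simp only [iff_false]
  exact fun h => h 0 (hp ▸ hv)

lemma esc_out (A : Set (Zd d)) (v : Zd d) (hv : v ∉ A) : esc W A v = av (esc W A) v := by
  have h1 := (Filter.tendsto_add_atTop_iff_nat 1).mpr (esc_lim W A v)
  simp only [avoid_out W A v hv] at h1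
  exact tendsto_nhds_unique h1 (av_tendsto (esc_lim W A) v)

lemma eqm_eq (A : Set (Zd d)) (y : Zd d) (hy : y ∈ A) : W.eqm A y = av (esc W A) y := by
  have := W.isProb y
  rw [SRW.eqm, if_pos hy]
  have e0 : W.P y {ω | W.hitTilde A ω = ⊤} = W.P y {ω | ∀ n, W.Y (n+1) ω ∉ A} := by
    apply measure_congr
    filter_upwards [ae_good W y] with ω hω
    exact propext (hitTilde_iff hω)
  rw [e0]
  have h2 := av_tendsto (esc_lim W A) y
  simp only [← avoid_shift W A y] at h2
  refine tendsto_nhds_unique ?_ h2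
  unfold pr
  have e : {ω | ∀ n, W.Y (n+1) ω ∉ A} = ⋂ n, {ω | ∀ k ≤ n, W.Y (k+1) ω ∉ A} := by
    ext ω; simp only [Set.mem_ofPred_eq, Set.mem_iInter]
    exact ⟨fun h n k _ => h k, fun h n => h n n le_rfl⟩
  rw [e]
  apply (ENNReal.tendsto_toReal (measure_ne_top _ _)).comp
  apply tendsto_measure_iInter_atTop
  · intro n
    have : dep (n+1) (fun p : ℕ → Zd d => ∀ k ≤ n, p (k+1) ∉ A) :=
      fun _ _ hpq h k hk => (hpq (k+1) (by omega)) ▸ h k hk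
    exact (dep_meas W this).nullMeasurableSet
  · intro m n hmn ω h k hk; exact h k (hk.trans hmn)
  · exact ⟨0, measure_ne_top _ _⟩

lemma esc_bound (hd : 3 ≤ d) (A : Set (Zd d)) (z : Zd d) (m : ℝ) (hm : 0 < m)
    (hA : ∀ w ∈ A, m ≤ bar (w - z)) (v : Zd d) : 1 - bar (v - z) / m ≤ esc W A v := by
  have key : ∀ n v, 1 - bar (v - z) / m ≤ pr W v (fun p => ∀ k ≤ n, p k ∉ A) := by
    intro n
    induction n with
    | zero =>
      intro v
      by_cases hv : v ∈ A
      · rw [avoid_in W A v hv]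
        have : 1 ≤ bar (v - z) / m := by rw [le_div_iff₀ hm, one_mul]; exact hA v hv
        linarith
      · have : pr W v (fun p => ∀ k ≤ 0, p k ∉ A) = 1 := by
          rw [← pr_true W v]; apply pr_congr; intro p hp
          simp [hp, hv]
        rw [this]
        have := (div_pos (bar_pos (v - z)) hm).le
        linarith
    | succ n ih =>
      intro v
      by_cases hv : v ∈ A
      · rw [avoid_in W A v hv]
        have : 1 ≤ bar (v - z) / m := by rw [le_div_iff₀ hm, one_mul]; exact hA v hv
        linarith
      · rw [avoid_out W A v hv]
        refine le_trans ?_ (av_mono (f := fun w => 1 - bar (w - z) / m) v fun j => ih (v + u j))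
        rw [av_sub (fun _ => 1) (fun w => bar (w - z) / m), av_const (by omega)]
        have e : av (fun w => bar (w - z) / m) v = av bar (v - z) / m := by
          have := av_smul m⁻¹ (fun w => bar (w - z)) v
          rw [av_shift bar z v] at this
          rw [div_eq_inv_mul, ← this]
          congr 1; funext w; rw [div_eq_inv_mul]
        rw [e]
        have := bar_super hd (v - z)
        gcongr
  exact ge_of_tendsto' (esc_lim W A v) fun n => key n v

lemma esc_nonneg (A : Set (Zd d)) (v : Zd d) : 0 ≤ esc W A v := pr_nonneg W v _

/-- probability of entering `C` at `y` -/
lemma hit_prob (hd : 3 ≤ d) (C : Set (Zd d)) (x y : Zd d) (hx : x ∉ C) (hy : y ∈ C) :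
    pr W x (fun p => ∃ n, p n = y ∧ ∀ k < n, p k ∉ C) = av (gg C x) y := by
  have := W.isProb x
  have hmeas : ∀ n, MeasurableSet {ω | W.Y n ω = y ∧ ∀ k < n, W.Y k ω ∉ C} := by
    intro n
    have : dep n (fun p : ℕ → Zd d => p n = y ∧ ∀ k < n, p k ∉ C) := by
      rintro p q hpq ⟨h1, h2⟩
      exact ⟨(hpq n le_rfl) ▸ h1, fun k hk => (hpq k hk.le) ▸ h2 k hk⟩
    exact dep_meas W this
  have e : {ω | ∃ n, W.Y n ω = y ∧ ∀ k < n, W.Y k ω ∉ C}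
      = ⋃ n, {ω | W.Y n ω = y ∧ ∀ k < n, W.Y k ω ∉ C} := by
    ext ω; simp
  rw [pr, e, measure_iUnion _ hmeas, ENNReal.tsum_toReal_eq (fun n => measure_ne_top _ _)]
  · have e2 : ∀ n, (W.P x {ω | W.Y n ω = y ∧ ∀ k < n, W.Y k ω ∉ C}).toReal = hh C n x y :=
      fun n => pr_hh W C n x y
    simp_rw [e2]
    have h0 : hh C 0 x y = 0 := by
      rw [hh, if_neg]; rintro rfl; exact hx hy
    have hsucc : ∀ n, hh C (n+1) x y = av (fun w => bb C n x w) y := fun n => hh_bb C n x y hy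
    have hs := (av_tsum hd C x y)
    have hsum : Summable (fun n => hh C n x y) := by
      rw [← summable_nat_add_iff 1]
      simp_rw [hsucc]; exact hs.2
    rw [hsum.tsum_eq_zero_add, h0, zero_add]
    simp_rw [hsucc]
    exact hs.1
  · intro m n hmn
    rw [Function.onFun, Set.disjoint_left]
    rintro ω ⟨h1, h2⟩ ⟨h3, h4⟩
    rcases lt_or_gt_of_ne hmn with h | h
    · exact h4 m h (h1 ▸ hy)
    · exact h2 n h (h3 ▸ hy)

end
end Pf

namespace Pf

lemma fin_bar_min {d : ℕ} (C : Set (Zd d)) (hC : C.Finite) : ∃ m : ℝ, 0 < m ∧ ∀ w ∈ C, m ≤ bar w := by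
  rcases C.eq_empty_or_nonempty with h | h
  · exact ⟨1, one_pos, by simp [h]⟩
  · obtain ⟨a, _, hm⟩ := hC.exists_minimalFor bar C h |>.imp fun a ha => (⟨ha.1, ha⟩ : _ ∧ _)
    refine ⟨bar a, bar_pos a, fun w hw => ?_⟩
    rcases le_total (bar a) (bar w) with h1 | h1
    · exact h1
    · exact hm.2 hw h1

lemma bar_ge_finite {d : ℕ} (m : ℝ) (hm : 0 < m) : {v : Zd d | m ≤ bar v}.Finite := by
  obtain ⟨N, hN⟩ := exists_nat_gt (m ^ (-(4:ℝ)))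
  apply (bx_finite (d := d) (N : ℤ)).subset
  intro v hv
  simp only [Set.mem_ofPred_eq, bar] at hv
  have hn := nsq_nonneg v
  have h1 : nsq v + 500 ≤ m ^ (-(4:ℝ)) := by
    have h2 : 0 < nsq v + 500 := by linarith
    have h3 := Real.rpow_le_rpow_of_nonpos hm hv (z := -(4:ℝ)) (by norm_num)
    rw [← Real.rpow_mul h2.le] at h3
    norm_num at h3
    simpa using h3
  have hN1 : (1:ℝ) ≤ N := by linarith
  intro i
  have h4 := sq_le_nsq v i
  have h5 : ((v i : ℝ)) ^ 2 ≤ (N:ℝ) ^ 2 := by nlinarith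
  have h6 := abs_le_of_sq_le_sq h5 (by positivity)
  have : (((|v i| : ℤ)) : ℝ) ≤ ((N : ℤ) : ℝ) := by push_cast; exact h6
  exact_mod_cast this

lemma add_u_true {d : ℕ} (v : Zd d) (i k : Fin d) :
    (v + u (i, true)) k = v k + if k = i then 1 else 0 := by
  simp [u, Pi.single_apply]

section
variable {d : ℕ} {Ω : Type*} [MeasurableSpace Ω] (W : SRW d Ω)

lemma esc_pos (hd : 3 ≤ d) (C : Set (Zd d)) (hCf : C.Finite) (L : ℕ) (hL : 1 ≤ L)
    (𝒞 : Finset (Zd d))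
    (hC : ∀ v, v ∈ C ↔ ∃ z ∈ 𝒞, ∀ i, z i - 4 * L ≤ v i ∧ v i < z i + 5 * L)
    (hsep : ∀ z ∈ 𝒞, ∀ z' ∈ 𝒞, z ≠ z' → ∃ i, (20 * L : ℤ) ≤ |z i - z' i|)
    (v : Zd d) (hv : v ∉ C) : 0 < esc W C v := by
  by_contra hcon
  have hv0 : esc W C v = 0 := le_antisymm (not_lt.mp hcon) (esc_nonneg W C v)
  obtain ⟨m, hm, hmC⟩ := fin_bar_min C hCf
  set Z : Set (Zd d) := {w | w ∉ C ∧ esc W C w = 0} with hZ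
  have hZf : Z.Finite := by
    apply (bar_ge_finite (d := d) m hm).subset
    rintro w ⟨_, hw⟩
    have := esc_bound W hd C 0 m hm (by simpa using hmC) w
    rw [hw, sub_zero] at this
    have h1 : 1 ≤ bar w / m := by linarith
    rw [le_div_iff₀ hm, one_mul] at h1
    exact h1
  have hcl : ∀ w ∈ Z, ∀ j, w + u j ∉ C → w + u j ∈ Z := by
    rintro w ⟨hw1, hw2⟩ j hj
    refine ⟨hj, ?_⟩
    have h1 := le_av (by omega) (esc_nonneg W C) w j
    rw [← esc_out W C w hw1, hw2, mul_zero] at h1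
    exact le_antisymm h1 (esc_nonneg W C _)
  let i0 : Fin d := ⟨0, by omega⟩
  let i1 : Fin d := ⟨1, by omega⟩
  have hi : i0 ≠ i1 := by simp [i0, i1]
  obtain ⟨w, hwZ, hmax⟩ : ∃ w ∈ Z, ∀ w' ∈ Z, w' i0 ≤ w i0 := by
    obtain ⟨w, hw, h⟩ := hZf.toFinset.exists_max_image (fun w => w i0) ⟨v, by simp [hZ, hv, hv0]⟩
    exact ⟨w, by simpa using hw, fun w' hw' => h w' (by simpa using hw')⟩
  have h1 : w + u (i0, true) ∈ C := by
    by_contra hc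
    have := hmax _ (hcl w hwZ _ hc)
    rw [add_u_true] at this
    simp at this
  obtain ⟨z, hz, hb⟩ := (hC _).mp h1
  simp only [add_u_true] at hb
  have hwC := hwZ.1
  have hw0 : w i0 + 1 = z i0 - 4 * L := by
    by_contra hc
    apply hwC
    rw [hC]
    refine ⟨z, hz, fun i => ?_⟩
    have := hb i
    by_cases hi : i = i0
    · subst hi; simp only [if_true] at this; omega
    · simp only [hi, if_false] at this; omega
  -- points close to the box of `z` but outside it
  have hout : ∀ q : Zd d, (∀ i, z i - 4 * L - 1 ≤ q i ∧ q i ≤ z i + 5 * L) →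
      (∃ i, q i = z i - 4 * L - 1 ∨ q i = z i + 5 * L) → q ∉ C := by
    rintro q hq ⟨k, hk⟩ hqC
    obtain ⟨z', hz', hb'⟩ := (hC _).mp hqC
    by_cases hzz : z = z'
    · subst hzz
      have := hb' k
      omega
    · obtain ⟨i, hi⟩ := hsep z hz z' hz' hzz
      have h1 := hq i
      have h2 := hb' i
      rcases le_abs.mp hi with h | h <;> omega
  have hb1 := hb i1
  rw [if_neg hi.symm, add_zero] at hb1
  have slide : ∀ t : ℕ, w i1 + t ≤ z i1 + 5 * L → (w + t • u (i1, true)) ∈ Z := by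
    intro t
    induction t with
    | zero => intro _; simpa using hwZ
    | succ t ih =>
      intro ht
      push_cast at ht
      have h := ih (by omega)
      rw [succ_nsmul, ← add_assoc]
      apply hcl _ h
      apply hout
      · intro i
        have := hb i
        rw [add_u_true]
        simp only [Pi.add_apply, Pi.smul_apply, u, Pi.single_apply]
        by_cases h1 : i = i1
        · subst h1
          simp; omega
        · by_cases h0 : i = i0
          · subst h0; simp [h1]; omega
          · simp [h1, h0] at this ⊢; omega
      · refine ⟨i0, Or.inl ?_⟩
        rw [add_u_true]
        simp only [Pi.add_apply, Pi.smul_apply, u, Pi.single_apply]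
        simp [hi]; omega
  obtain ⟨T, hT⟩ : ∃ T : ℕ, w i1 + T = z i1 + 5 * L := ⟨(z i1 + 5 * L - w i1).toNat, by omega⟩
  have hTZ := slide T (by omega)
  have hfin : (w + T • u (i1, true)) + u (i0, true) ∈ Z := by
    apply hcl _ hTZ
    apply hout
    · intro i
      have := hb i
      rw [add_u_true]
      simp only [Pi.add_apply, Pi.smul_apply, u, Pi.single_apply]
      by_cases h1 : i = i1
      · subst h1
        simp [hi.symm]; omega
      · by_cases h0 : i = i0
        · subst h0; simp [h1]; omega
        · simp [h1, h0] at this ⊢; omega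
    · refine ⟨i1, Or.inr ?_⟩
      rw [add_u_true]
      simp only [Pi.add_apply, Pi.smul_apply, u, Pi.single_apply]
      simp [hi.symm]; omega
  have := hmax _ hfin
  rw [add_u_true] at this
  simp [u, Pi.single_apply, hi] at this

lemma cap_eq (A : Set (Zd d)) (hA : A.Finite) : W.cap A = ∑ y ∈ hA.toFinset, W.eqm A y := by
  rw [SRW.cap]
  apply finsum_eq_sum_of_support_subset
  intro y hy
  simp only [Set.Finite.coe_toFinset]
  by_contra h
  simp [SRW.eqm, h] at hy

lemma eqm_nonneg (A : Set (Zd d)) (y : Zd d) : 0 ≤ W.eqm A y := by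
  rw [SRW.eqm]; split_ifs
  · exact ENNReal.toReal_nonneg
  · exact le_rfl

lemma cap_pos (hd : 3 ≤ d) (C : Set (Zd d)) (hCf : C.Finite)
    (y : Zd d) (hy : y ∈ C) (j) (hj : 0 < esc W C (y + u j)) : 0 < W.cap C := by
  rw [cap_eq W C hCf]
  apply Finset.sum_pos' (fun y _ => eqm_nonneg W C y)
  refine ⟨y, by simpa using hy, ?_⟩
  rw [eqm_eq W C y hy]
  have h1 := le_av (by omega) (esc_nonneg W C) y j
  have h2 : 0 < 2 * (d:ℝ) * av (esc W C) y := hj.trans_le h1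
  by_contra hc
  have : 2 * (d:ℝ) * av (esc W C) y ≤ 0 := mul_nonpos_of_nonneg_of_nonpos (by positivity) (not_lt.mp hc)
  linarith

end
end Pf

namespace Pf

section
variable {d : ℕ} {Ω : Type*} [MeasurableSpace Ω] (W : SRW d Ω)

lemma ebar_sum (A : Set (Zd d)) (hA : A.Finite) (hc : 0 < W.cap A) :
    ∑' x, ENNReal.ofReal (W.ebar A x) = 1 := by
  rw [tsum_eq_sum (s := hA.toFinset)]
  · rw [← ENNReal.ofReal_sum_of_nonneg]
    · simp only [SRW.ebar]
      rw [← Finset.sum_div, ← cap_eq W A hA, div_self hc.ne']; simp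
    · intro y _; exact div_nonneg (eqm_nonneg W A y) hc.le
  · intro y hy
    have : y ∉ A := by simpa using hy
    simp [SRW.ebar, SRW.eqm, this]

lemma pinit_prob (A : Set (Zd d)) (hA : A.Finite) (hc : 0 < W.cap A) :
    IsProbabilityMeasure (W.Pinit (W.ebar A)) := by
  constructor
  rw [SRW.Pinit, Measure.sum_apply _ MeasurableSet.univ]
  rw [← ebar_sum W A hA hc]
  congr 1; funext x
  have := W.isProb x
  simp

lemma pinit_Y0 (ρ : Zd d → ℝ) (y : Zd d) :
    W.Pinit ρ {ω | W.Y 0 ω = y} = ENNReal.ofReal (ρ y) := by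
  have hm : MeasurableSet {ω | W.Y 0 ω = y} := W.measurable_Y 0 (measurableSet_singleton y)
  rw [SRW.Pinit, Measure.sum_apply _ hm, tsum_eq_single y]
  · rw [Measure.smul_apply, W.Y_zero y]; simp
  · intro x hx
    rw [Measure.smul_apply]
    have : W.P x {ω | W.Y 0 ω = y} = 0 := by
      have h : ∀ᵐ ω ∂(W.P x), ¬ W.Y 0 ω = y := by
        filter_upwards [ae_Y0 W x] with ω hω h
        exact hx (hω ▸ h.symm ▸ rfl)
      rw [ae_iff] at h
      simpa using h
    simp [this]

lemma pinit_good (ρ : Zd d → ℝ) : ∀ᵐ ω ∂(W.Pinit ρ), good W ω := by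
  rw [SRW.Pinit, Measure.ae_sum_iff]
  · intro x
    exact Measure.ae_smul_measure (ae_good W x) _

/-- the entrance variable -/
noncomputable def yrv (C : Set (Zd d)) : Ω × Ω → Zd d :=
  fun ω => if W.hit C ω.1 ≠ ⊤ then W.Xat (W.hit C) ω.1 else W.X 0 ω.2

/-- measurable version of the event that the entrance variable is `y` -/
def ev (C : Set (Zd d)) (y : Zd d) : Set (Ω × Ω) :=
  ({ω | ∃ n, W.Y n ω = y ∧ ∀ k < n, W.Y k ω ∉ C} ×ˢ Set.univ) ∪
  ({ω | ∀ n, W.Y n ω ∉ C} ×ˢ {ω | W.Y 0 ω = y})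

lemma yrv_iff (C : Set (Zd d)) (y : Zd d) (hy : y ∈ C) (ω : Ω × Ω) (h1 : good W ω.1)
    (h2 : good W ω.2) : yrv W C ω = y ↔ ω ∈ ev W C y := by
  simp only [ev, Set.mem_union, Set.mem_prod, Set.mem_ofPred_eq, Set.mem_univ, and_true]
  by_cases hh : ∃ n, W.Y n ω.1 ∈ C
  · have hn := Nat.find_spec hh
    have hk : ∀ k < Nat.find hh, W.Y k ω.1 ∉ C := fun k hk => Nat.find_min hh hk
    obtain ⟨ha, hb⟩ := hit_ne_top h1 hn hk
    rw [yrv, if_pos ha, hb]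
    constructor
    · intro h; exact Or.inl ⟨_, h, hk⟩
    · rintro (⟨n, hn1, hn2⟩ | ⟨h, _⟩)
      · have : Nat.find hh = n := by
          rw [Nat.find_eq_iff]
          exact ⟨hn1 ▸ hy, hn2⟩
        rw [this, hn1]
      · exact absurd hn (h _)
  · push Not at hh
    rw [yrv, if_neg (by simp [hit_top hh]), X_zero h2]
    constructor
    · intro h; exact Or.inr ⟨hh, h⟩
    · rintro (⟨n, hn1, hn2⟩ | ⟨_, h⟩)
      · exact absurd (hn1 ▸ hy) (hh n)
      · exact h

lemma meas_E (C : Set (Zd d)) (y : Zd d) :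
    MeasurableSet {ω | ∃ n, W.Y n ω = y ∧ ∀ k < n, W.Y k ω ∉ C} := by
  rw [Set.ofPred_exists]
  refine MeasurableSet.iUnion fun n => ?_
  have : dep n (fun p : ℕ → Zd d => p n = y ∧ ∀ k < n, p k ∉ C) := by
    rintro p q hpq ⟨h1, h2⟩
    exact ⟨(hpq n le_rfl) ▸ h1, fun k hk => (hpq k hk.le) ▸ h2 k hk⟩
  exact dep_meas W this

lemma meas_N (C : Set (Zd d)) : MeasurableSet {ω | ∀ n, W.Y n ω ∉ C} := by
  rw [Set.ofPred_forall]
  refine MeasurableSet.iInter fun n => ?_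
  exact W.measurable_Y n (Set.to_countable Cᶜ).measurableSet

lemma meas_F (y : Zd d) : MeasurableSet {ω | W.Y 0 ω = y} :=
  W.measurable_Y 0 (measurableSet_singleton y)

lemma meas_ev (C : Set (Zd d)) (y : Zd d) : MeasurableSet (ev W C y) :=
  ((meas_E W C y).prod MeasurableSet.univ).union ((meas_N W C).prod (meas_F W y))

lemma ev_disj (C : Set (Zd d)) (y y' : Zd d) (hy : y ∈ C) (hy' : y' ∈ C) (hne : y ≠ y') :
    Disjoint (ev W C y) (ev W C y') := by
  rw [Set.disjoint_left]
  intro ω h h'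
  simp only [ev, Set.mem_union, Set.mem_prod, Set.mem_ofPred_eq, Set.mem_univ, and_true] at h h'
  rcases h with ⟨n, h1, h2⟩ | ⟨h1, h2⟩
  · rcases h' with ⟨m, h3, h4⟩ | ⟨h3, h4⟩
    · rcases lt_trichotomy m n with h | h | h
      · exact h2 m h (h3 ▸ hy')
      · subst h; exact hne (h1.symm.trans h3)
      · exact h4 n h (h1 ▸ hy)
    · exact h3 n (h1 ▸ hy)
  · rcases h' with ⟨m, h3, h4⟩ | ⟨h3, h4⟩
    · exact h1 m (h3 ▸ hy')
    · exact hne (h2.symm.trans h4)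

/-- the harmonic function governing the entrance law -/
noncomputable def JJ (C : Set (Zd d)) (x v : Zd d) : ℝ :=
  gg C x v + esc W C x / W.cap C * esc W C v

lemma ev_prob (hd : 3 ≤ d) (C : Set (Zd d)) (hCf : C.Finite) (hc : 0 < W.cap C) (x y : Zd d)
    (hx : x ∉ C) (hy : y ∈ C) :
    (((W.P x).prod (W.Pinit (W.ebar C))) (ev W C y)).toReal = av (JJ W C x) y := by
  have := W.isProb x
  have := pinit_prob W C hCf hc
  rw [ev, measure_union _ ((meas_N W C).prod (meas_F W y)), Measure.prod_prod, Measure.prod_prod,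
    measure_univ, mul_one, ENNReal.toReal_add (measure_ne_top _ _)
      (ENNReal.mul_ne_top (measure_ne_top _ _) (measure_ne_top _ _)), ENNReal.toReal_mul,
    pinit_Y0, ENNReal.toReal_ofReal (show 0 ≤ W.ebar C y from div_nonneg (eqm_nonneg W C y) hc.le)]
  · have h1 := hit_prob W hd C x y hx hy
    rw [pr] at h1
    rw [h1]
    have h2 : (W.P x {ω | ∀ n, W.Y n ω ∉ C}).toReal = esc W C x := rfl
    rw [h2]
    unfold JJ
    rw [av_add, av_smul, SRW.ebar, eqm_eq W C y hy]
    ring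
  · rw [Set.disjoint_left]
    rintro ω ⟨⟨n, h1, _⟩, _⟩ ⟨h2, _⟩
    exact h2 n (h1 ▸ hy)

lemma good_ae (C : Set (Zd d)) (hCf : C.Finite) (hc : 0 < W.cap C) (x : Zd d) :
    ∀ᵐ ω ∂((W.P x).prod (W.Pinit (W.ebar C))), good W ω.1 ∧ good W ω.2 := by
  have := W.isProb x
  have := pinit_prob W C hCf hc
  have h1 := Measure.quasiMeasurePreserving_fst (μ := W.P x) (ν := W.Pinit (W.ebar C)) |>.ae
    (ae_good W x)
  have h2 := Measure.quasiMeasurePreserving_snd (μ := W.P x) (ν := W.Pinit (W.ebar C)) |>.ae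
    (pinit_good W (W.ebar C))
  filter_upwards [h1, h2] with ω a b using ⟨a, b⟩

lemma num_prob (hd : 3 ≤ d) (C D : Set (Zd d)) (hCf : C.Finite) (hDC : D ⊆ C)
    (hc : 0 < W.cap C) (x y : Zd d) (hx : x ∉ C) (hy : y ∈ D) :
    (((W.P x).prod (W.Pinit (W.ebar C))) {ω | yrv W C ω = y ∧ yrv W C ω ∈ D}).toReal
      = av (JJ W C x) y := by
  rw [← ev_prob W hd C hCf hc x y hx (hDC hy)]
  congr 1
  apply measure_congr
  filter_upwards [good_ae W C hCf hc x] with ω hω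
  apply propext
  have := yrv_iff W C y (hDC hy) ω hω.1 hω.2
  change (yrv W C ω = y ∧ yrv W C ω ∈ D) ↔ ω ∈ ev W C y
  rw [← this]
  exact ⟨fun h => h.1, fun h => ⟨h, h ▸ hy⟩⟩

lemma den_prob (hd : 3 ≤ d) (C D : Set (Zd d)) (hCf : C.Finite) (hDf : D.Finite) (hDC : D ⊆ C)
    (hc : 0 < W.cap C) (x : Zd d) (hx : x ∉ C) :
    (((W.P x).prod (W.Pinit (W.ebar C))) {ω | yrv W C ω ∈ D}).toReal
      = ∑ y ∈ hDf.toFinset, av (JJ W C x) y := by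
  have := W.isProb x
  have := pinit_prob W C hCf hc
  have e : ((W.P x).prod (W.Pinit (W.ebar C))) {ω | yrv W C ω ∈ D}
      = ((W.P x).prod (W.Pinit (W.ebar C))) (⋃ y ∈ hDf.toFinset, ev W C y) := by
    apply measure_congr
    filter_upwards [good_ae W C hCf hc x] with ω hω
    apply propext
    change (yrv W C ω ∈ D) ↔ ω ∈ (⋃ y ∈ hDf.toFinset, ev W C y)
    simp only [Set.mem_iUnion, Set.Finite.mem_toFinset, exists_prop]
    constructor
    · intro h
      exact ⟨_, h, (yrv_iff W C _ (hDC h) ω hω.1 hω.2).mp rfl⟩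
    · rintro ⟨y, hy, h⟩
      rw [(yrv_iff W C y (hDC hy) ω hω.1 hω.2).mpr h]; exact hy
  rw [e, measure_biUnion_finset, ENNReal.toReal_sum (fun _ _ => measure_ne_top _ _)]
  · apply Finset.sum_congr rfl
    intro y hy
    exact ev_prob W hd C hCf hc x y hx (hDC (by simpa using hy))
  · intro y hy y' hy' hne
    exact ev_disj W C y y' (hDC (by simpa using hy)) (hDC (by simpa using hy')) hne
  · intro y _; exact meas_ev W C y

lemma JJ_nonneg (C : Set (Zd d)) (hc : 0 < W.cap C) (x v : Zd d) : 0 ≤ JJ W C x v :=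
  add_nonneg (gg_nonneg C x v)
    (mul_nonneg (div_nonneg (esc_nonneg W C x) hc.le) (esc_nonneg W C v))

lemma JJ_in (C : Set (Zd d)) (x v : Zd d) (hv : v ∈ C) : JJ W C x v = 0 := by
  rw [JJ, gg_end C x v hv, esc_in W C v hv]; simp

lemma JJ_harm (hd : 3 ≤ d) (C : Set (Zd d)) (x v : Zd d) (hv : v ∉ C) (hvx : v ≠ x) :
    JJ W C x v = av (JJ W C x) v := by
  have : av (JJ W C x) v = av (gg C x) v + esc W C x / W.cap C * av (esc W C) v := by
    unfold JJ; rw [av_add, av_smul]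
  rw [this, JJ, gg_harm hd C x v hv hvx, ← esc_out W C v hv]

/-- final algebra -/
lemma final_alg {ι : Type*} (s : Finset ι) (A e : ι → ℝ) (ε : ℝ) (hε : 0 < ε) (hε1 : ε ≤ 1)
    (hA : ∀ y ∈ s, 0 ≤ A y) (he : ∀ y ∈ s, 0 ≤ e y) (hApos : 0 < ∑ y ∈ s, A y)
    (hepos : 0 < ∑ y ∈ s, e y)
    (h : ∀ y ∈ s, ∀ y' ∈ s, A y * e y' ≤ (1 + ε) * (A y' * e y)) (y : ι) (hy : y ∈ s) :
    (1 - ε) * (e y / ∑ y ∈ s, e y) ≤ A y / (∑ y ∈ s, A y) ∧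
      A y / (∑ y ∈ s, A y) ≤ (1 + ε) * (e y / ∑ y ∈ s, e y) := by
  have h1 : A y * ∑ y' ∈ s, e y' ≤ (1 + ε) * ((∑ y' ∈ s, A y') * e y) := by
    rw [Finset.mul_sum, Finset.sum_mul, Finset.mul_sum]
    exact Finset.sum_le_sum fun y' hy' => h y hy y' hy'
  have h2 : (∑ y' ∈ s, A y') * e y ≤ (1 + ε) * (A y * ∑ y' ∈ s, e y') := by
    rw [Finset.mul_sum, Finset.sum_mul, Finset.mul_sum]
    exact Finset.sum_le_sum fun y' hy' => h y' hy' y hy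
  set SA := ∑ y' ∈ s, A y'
  set Se := ∑ y' ∈ s, e y'
  have hAy := hA y hy
  constructor
  · rw [← mul_div_assoc, div_le_div_iff₀ hepos hApos]
    have h3 : (1 - ε) * (SA * e y) ≤ (1 - ε) * ((1 + ε) * (A y * Se)) :=
      mul_le_mul_of_nonneg_left h2 (by linarith)
    have h4 : 0 ≤ A y * Se := mul_nonneg hAy hepos.le
    have h5 : (1 - ε) * ((1 + ε) * (A y * Se)) ≤ A y * Se := by
      have : (1 - ε) * ((1 + ε) * (A y * Se)) = A y * Se - ε ^ 2 * (A y * Se) := by ring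
      rw [this]
      have : 0 ≤ ε ^ 2 * (A y * Se) := by positivity
      linarith
    calc (1 - ε) * e y * SA = (1 - ε) * (SA * e y) := by ring
      _ ≤ _ := h3.trans h5
  · rw [← mul_div_assoc, div_le_div_iff₀ hApos hepos]
    calc A y * Se ≤ _ := h1
      _ = _ := by ring

end
end Pf

/-- (4.5) and (4.11) of Proposition 4.1: for `K ≥ c₆(δ)`, for `Q_x`
governing two independent walks `X¹` (from `x`) and `X²` (from `ē_Č`), and
`Y = X¹_{H_Č}` if `H_Č(X¹) < ∞`, `Y = X²₀` otherwise, one has, for `z ∈ 𝒞`, `y ∈ Ď_z`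
and `x ∈ ∂V̌`, `(1 − δ/3)·ē_{Ď_z}(y) ≤ Q_x[Y = y | Y ∈ Ď_z] ≤ (1 + δ/3)·ē_{Ď_z}(y)`. -/
theorem statement13 {d : ℕ} (hd : 3 ≤ d) {Ω : Type*} [MeasurableSpace Ω] (W : SRW d Ω)
    (δ : ℝ) (hδ0 : 0 < δ) (hδ1 : δ < 1 / 2) :
    ∃ c₆ : ℝ, ∀ (L K : ℕ), 1 ≤ L → c₆ ≤ (K : ℝ) → 100 ≤ K →
      ∀ 𝒞 : Finset (Zd d), 𝒞.Nonempty →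
        (∀ z ∈ 𝒞, ∀ i, (L : ℤ) ∣ z i) →
        (∀ z ∈ 𝒞, ∀ z' ∈ 𝒞, z ≠ z' → (2 * K + 3) * L ≤ supDist z z') →
        let Cc : Set (Zd d) :=
          ⋃ z' ∈ (𝒞 : Set (Zd d)), (z' + ·) '' (intBox (-(4 * L : ℤ)) (5 * L) : Set (Zd d));
        let Vc : Set (Zd d) :=
          ⋃ z' ∈ (𝒞 : Set (Zd d)),
            (z' + ·) ''
              (intBox (-(((K : ℤ) + 1) * L) + 1) (((K : ℤ) + 1) * L - 1) : Set (Zd d));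
        let Yrv : Ω × Ω → Zd d :=
          fun ω => if W.hit Cc ω.1 ≠ ⊤ then W.Xat (W.hit Cc) ω.1 else W.X 0 ω.2;
        ∀ z ∈ 𝒞, ∀ y ∈ (z + ·) '' (intBox (-(4 * L : ℤ)) (5 * L) : Set (Zd d)),
          ∀ x ∈ bdry Vc,
            (1 - δ / 3) *
                W.ebar ((z + ·) '' (intBox (-(4 * L : ℤ)) (5 * L) : Set (Zd d))) y ≤
              (((W.P x).prod (W.Pinit (W.ebar Cc)))
                    {ω : Ω × Ω | Yrv ω = y ∧
                      Yrv ω ∈ (z + ·) '' (intBox (-(4 * L : ℤ)) (5 * L) : Set (Zd d))}).toReal /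
                (((W.P x).prod (W.Pinit (W.ebar Cc)))
                    {ω : Ω × Ω |
                      Yrv ω ∈ (z + ·) '' (intBox (-(4 * L : ℤ)) (5 * L) : Set (Zd d))}).toReal ∧
            (((W.P x).prod (W.Pinit (W.ebar Cc)))
                  {ω : Ω × Ω | Yrv ω = y ∧
                    Yrv ω ∈ (z + ·) '' (intBox (-(4 * L : ℤ)) (5 * L) : Set (Zd d))}).toReal /
                (((W.P x).prod (W.Pinit (W.ebar Cc)))
                    {ω : Ω × Ω |
                      Yrv ω ∈ (z + ·) '' (intBox (-(4 * L : ℤ)) (5 * L) : Set (Zd d))}).toReal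
              ≤ (1 + δ / 3) *
                  W.ebar ((z + ·) '' (intBox (-(4 * L : ℤ)) (5 * L) : Set (Zd d))) y := by
  obtain ⟨K0, hK0⟩ := Pf.aml hd (δ / 3) (by linarith) (by linarith)
  refine ⟨K0, fun L K hL hK hK100 𝒞 hne hdvd hsep => ?_⟩
  intro Cc Vc Yrv z hz y hy x hx
  have hYrv : Yrv = Pf.yrv W Cc := rfl
  rw [hYrv]
  set D : Set (Zd d) := (z + ·) '' (intBox (-(4 * L : ℤ)) (5 * L) : Set (Zd d)) with hDdef
  have himg : ∀ (z' v : Zd d), v ∈ (z' + ·) '' (intBox (-(4 * L : ℤ)) (5 * L) : Set (Zd d)) ↔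
      ∀ i, z' i - 4 * L ≤ v i ∧ v i < z' i + 5 * L := by
    intro z' v
    constructor
    · rintro ⟨w, hw, rfl⟩ i
      have := hw i
      simp only [Pi.add_apply]; omega
    · intro h
      refine ⟨v - z', fun i => ?_, by simp⟩
      have := h i
      simp only [Pi.sub_apply]; omega
  have hCmem : ∀ v, v ∈ Cc ↔ ∃ z' ∈ 𝒞, ∀ i, z' i - 4 * L ≤ v i ∧ v i < z' i + 5 * L := by
    intro v
    simp only [Cc, Set.mem_iUnion, himg, Finset.mem_coe, exists_prop]
  have hDmem : ∀ v, v ∈ D ↔ ∃ z' ∈ ({z} : Finset (Zd d)),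
      ∀ i, z' i - 4 * L ≤ v i ∧ v i < z' i + 5 * L := by
    intro v
    rw [hDdef, himg]; simp
  have hDC : D ⊆ Cc := by
    intro v hv
    obtain ⟨z', hz', h⟩ := (hDmem v).mp hv
    rw [Finset.mem_singleton] at hz'
    subst hz'
    exact (hCmem v).mpr ⟨z', hz, h⟩
  have hboxf : (intBox (-(4 * L : ℤ)) (5 * L) : Set (Zd d)).Finite :=
    (Pf.bx_finite _).subset fun v hv => Pf.box_sub_bx hv
  have hCf : Cc.Finite := 𝒞.finite_toSet.biUnion fun z' _ => hboxf.image _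
  have hDf : D.Finite := hCf.subset hDC
  have hLz : (1 : ℤ) ≤ L := by exact_mod_cast hL
  have hKz : (100 : ℤ) ≤ K := by exact_mod_cast hK100
  have hKL : (100 : ℤ) * L ≤ K * L := by nlinarith
  have hsep' : ∀ z₁ ∈ 𝒞, ∀ z₂ ∈ 𝒞, z₁ ≠ z₂ → ∃ i, (2 * (K * L : ℤ) + 3 * L) ≤ |z₁ i - z₂ i| := by
    intro z₁ h1 z₂ h2 h12
    have h := hsep z₁ h1 z₂ h2 h12
    by_contra hc
    push Not at hc
    have : supDist z₁ z₂ < (2 * K + 3) * L := by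
      rw [supDist, Finset.sup_lt_iff]
      · intro i _
        have h3 := hc i
        zify
        linarith
      · rw [Nat.bot_eq_zero]; positivity
    omega
  have hsepC : ∀ z₁ ∈ 𝒞, ∀ z₂ ∈ 𝒞, z₁ ≠ z₂ → ∃ i, (20 * L : ℤ) ≤ |z₁ i - z₂ i| := by
    intro z₁ h1 z₂ h2 h12
    obtain ⟨i, hi⟩ := hsep' z₁ h1 z₂ h2 h12
    exact ⟨i, by linarith⟩
  have hsepD : ∀ z₁ ∈ ({z} : Finset (Zd d)), ∀ z₂ ∈ ({z} : Finset (Zd d)), z₁ ≠ z₂ →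
      ∃ i, (20 * L : ℤ) ≤ |z₁ i - z₂ i| := by
    intro z₁ h1 z₂ h2 h12
    simp only [Finset.mem_singleton] at h1 h2
    exact absurd (h1.trans h2.symm) h12
  have hescC := Pf.esc_pos W hd Cc hCf L hL 𝒞 hCmem hsepC
  have hescD := Pf.esc_pos W hd D hDf L hL {z} hDmem hsepD
  -- points near `z`
  have hnear : ∀ v ∈ Pf.bx (((K : ℤ) - 1) * L), v ∉ (intBox (-(4 * L : ℤ)) (5 * L) : Set (Zd d)) →
      z + v ∉ Cc := by
    intro v hv hvb hc
    obtain ⟨z', hz', h⟩ := (hCmem _).mp hc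
    by_cases hzz : z = z'
    · subst hzz
      apply hvb
      intro i
      have := h i
      simp only [Pi.add_apply] at this
      omega
    · obtain ⟨i, hi⟩ := hsep' z hz z' hz' hzz
      have h1 := h i
      have h2 := abs_le.mp (hv i)
      simp only [Pi.add_apply] at h1
      rw [sub_mul, one_mul] at h2
      rcases le_abs.mp hi with h | h <;> linarith
  have hxV : ∀ v ∈ Pf.bx (((K : ℤ) - 1) * L), z + v ≠ x := by
    intro v hv hvx
    apply hx.1
    simp only [Vc, Set.mem_iUnion]
    refine ⟨z, hz, v, fun i => ?_, hvx⟩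
    have h2 := abs_le.mp (hv i)
    rw [sub_mul, one_mul] at h2
    rw [add_mul, one_mul]
    constructor <;> linarith
  have hxC : x ∉ Cc := by
    intro hc
    obtain ⟨z', hz', h⟩ := (hCmem _).mp hc
    apply hx.1
    simp only [Vc, Set.mem_iUnion]
    refine ⟨z', hz', x - z', fun i => ?_, by simp⟩
    have h1 := h i
    rw [add_mul, one_mul]
    simp only [Pi.sub_apply]
    constructor <;> linarith
  -- a point just outside the box
  let i0 : Fin d := ⟨0, by omega⟩
  set q : Zd d := Pi.single i0 (5 * L - 1 : ℤ) with hq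
  set q' : Zd d := Pi.single i0 (5 * L : ℤ) with hq'
  have hqq : q + Pf.u (i0, true) = q' := by
    simp only [hq, hq', Pf.u, if_true, ← Pi.single_add]
    congr 1; ring
  have hqD : z + q ∈ D := by
    refine ⟨q, fun i => ?_, rfl⟩
    by_cases h : i = i0
    · subst h; simp only [hq, Pi.single_eq_same]; constructor <;> linarith
    · rw [hq, Pi.single_eq_of_ne h]; constructor <;> linarith
  have hq'bx : q' ∈ Pf.bx (5 * L : ℤ) := by
    intro i
    by_cases h : i = i0
    · subst h; simp only [hq', Pi.single_eq_same]; rw [abs_of_nonneg (by linarith)]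
    · rw [hq', Pi.single_eq_of_ne h]; simp
  have hq'C : z + q' ∉ Cc := by
    apply hnear
    · refine Pf.bx_mono ?_ hq'bx
      rw [sub_mul, one_mul]; linarith
    · intro h
      have := (h i0).2
      simp [hq'] at this
  have hq'D : z + q' ∉ D := fun h => hq'C (hDC h)
  have hcapC : 0 < W.cap Cc := by
    apply Pf.cap_pos W hd Cc hCf (z + q) (hDC hqD) (i0, true)
    rw [add_assoc, hqq]; exact hescC _ hq'C
  have hcapD : 0 < W.cap D := by
    apply Pf.cap_pos W hd D hDf (z + q) hqD (i0, true)
    rw [add_assoc, hqq]; exact hescD _ hq'D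
  have hJpos : 0 < Pf.JJ W Cc x (z + q') := by
    apply add_pos_of_nonneg_of_pos (Pf.gg_nonneg _ _ _)
    exact mul_pos (div_pos (hescC x hxC) hcapC) (hescC _ hq'C)
  have main := hK0 L K hL hK100 hK (fun v => Pf.JJ W Cc x (z + v)) (fun v => Pf.esc W D (z + v))
    (fun v => Pf.JJ_nonneg W Cc hcapC x _) (fun v => Pf.esc_nonneg W D _)
    (fun v hv => Pf.JJ_in W Cc x _ (hDC ⟨v, hv, rfl⟩))
    (fun v hv => Pf.esc_in W D _ ⟨v, hv, rfl⟩)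
    (fun v hv hvb => by
      rw [Pf.av_shift' (Pf.JJ W Cc x)]
      exact Pf.JJ_harm W hd Cc x _ (hnear v hv hvb) (hxV v hv))
    (fun v hv hvb => by
      rw [Pf.av_shift' (Pf.esc W D)]
      exact Pf.esc_out W D _ fun h => hnear v hv hvb (hDC h))
    ⟨q', hq'bx, hJpos⟩ ⟨q', hq'bx, hescD _ hq'D⟩
  have hAe : ∀ y ∈ hDf.toFinset, ∀ y' ∈ hDf.toFinset,
      Pf.av (Pf.JJ W Cc x) y * W.eqm D y' ≤
        (1 + δ / 3) * (Pf.av (Pf.JJ W Cc x) y' * W.eqm D y) := by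
    intro y hy y' hy'
    rw [Set.Finite.mem_toFinset] at hy hy'
    rw [Pf.eqm_eq W D y hy, Pf.eqm_eq W D y' hy']
    obtain ⟨w, hw, rfl⟩ := hy
    obtain ⟨w', hw', rfl⟩ := hy'
    have := main w hw w' hw'
    simp only [Pf.av_shift' (Pf.JJ W Cc x), Pf.av_shift' (Pf.esc W D)] at this
    exact this
  rw [Pf.num_prob W hd Cc D hCf hDC hcapC x y hxC hy, Pf.den_prob W hd Cc D hCf hDf hDC hcapC x hxC,
    SRW.ebar, Pf.cap_eq W D hDf]
  apply Pf.final_alg hDf.toFinset (Pf.av (Pf.JJ W Cc x)) (W.eqm D) (δ / 3) (by linarith)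
    (by linarith)
  · intro y _; exact Pf.av_nonneg (Pf.JJ_nonneg W Cc hcapC x) y
  · intro y _; exact Pf.eqm_nonneg W D y
  · apply Finset.sum_pos' (fun y _ => Pf.av_nonneg (Pf.JJ_nonneg W Cc hcapC x) y)
    refine ⟨z + q, by simpa using hqD, ?_⟩
    have h1 := Pf.le_av (by omega) (Pf.JJ_nonneg W Cc hcapC x) (z + q) (i0, true)
    rw [add_assoc, hqq] at h1
    have h2 := hJpos.trans_le h1
    by_contra hc
    have := mul_nonpos_of_nonneg_of_nonpos (a := 2 * (d : ℝ)) (by positivity) (not_lt.mp hc)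
    linarith
  · rw [← Pf.cap_eq W D hDf]; exact hcapD
  · exact hAe
  · simpa using hy
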